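/- Let {q_k : k ∈ ℕ} be a non-decreasing sequence of nonnegative reals with q_0 > 0. Then there exists a constant c > 0, depending only on λ = sup_k m_k, such that for every martingale f ∈ H_{1/2} the maximal operator of the Nörlund means t* f := sup_{n≥1} |t_n f| satisfies ‖t* f‖_{weak-L_{1/2}} ≤ c · ‖f‖_{H_{1/2}}. -/

import Mathlib

open MeasureTheory Complex Finset
open scoped BigOperators ENNReal NNReal

noncomputable section

instance (n : ℕ) : MeasurableSpace (ZMod n) := ⊤

/-- The Vilenkin group determined by the generating sequence `m`. -/
abbrev Gm (m : ℕ → ℕ) : Type := ∀ _k : ℕ, ZMod (m _k)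

namespace Vilenkin

variable (m : ℕ → ℕ)

/-- The generalized powers `M_0 = 1`, `M_{k+1} = m_k · M_k`. -/
def M : ℕ → ℕ
  | 0 => 1
  | k + 1 => m k * M k

/-- The `j`-th digit `n_j` of `n` in the generalized number system based on `m`. -/
def digit (n j : ℕ) : ℕ := n / M m j % m j

/-- `|n|`, the index of the highest nonzero digit of `n`. -/
def hi (n : ℕ) : ℕ := Nat.findGreatest (fun j => digit m n j ≠ 0) n

/-- `⟨n⟩`, the index of the lowest nonzero digit of `n`. -/
def lo (n : ℕ) : ℕ := sInf {j | digit m n j ≠ 0}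

/-- The generalized Rademacher functions `r_k(x) = exp(2πi x_k / m_k)`. -/
def rad (k : ℕ) (x : Gm m) : ℂ :=
  Complex.exp (2 * Real.pi * Complex.I * ((x k).val : ℂ) / (m k : ℂ))

/-- The Vilenkin functions `ψ_n = ∏_k r_k^{n_k}`. -/
def vil (n : ℕ) (x : Gm m) : ℂ :=
  ∏ k ∈ Finset.range (n + 1), rad m k x ^ digit m n k

/-- The Dirichlet kernels `D_n = ∑_{k=0}^{n-1} ψ_k`. -/
def D (n : ℕ) (x : Gm m) : ℂ := ∑ k ∈ Finset.range n, vil m k x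

/-- The Fejér kernels `K_n = (1/n) ∑_{k=1}^{n} D_k`. -/
def K (n : ℕ) (x : Gm m) : ℂ := (n : ℂ)⁻¹ * ∑ k ∈ Finset.range n, D m (k + 1) x

/-- The Nörlund kernels `F_n = (1/Q_n) ∑_{k=1}^{n} q_{n-k} D_k` where
`Q_n = ∑_{k=0}^{n-1} q_k`. -/
def FK (q : ℕ → ℝ) (n : ℕ) (x : Gm m) : ℂ :=
  ((∑ k ∈ Finset.range n, q k : ℝ) : ℂ)⁻¹ *
    ∑ k ∈ Finset.range n, (q (n - (k + 1)) : ℂ) * D m (k + 1) x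

/-- The cylinder subgroup `I_n = {x : x_0 = … = x_{n-1} = 0}`. -/
def I (n : ℕ) : Set (Gm m) := {x | ∀ k < n, x k = 0}

/-- The cylinder of length `n` around `x`. -/
def cylAt (n : ℕ) (x : Gm m) : Set (Gm m) := {y | ∀ k < n, y k = x k}

/-- `μ` is the normalized Haar measure of `G_m`: the (unique) Borel probability
measure giving each cylinder of length `n` measure `1 / M_n`. -/
def IsHaar (μ : Measure (Gm m)) : Prop :=
  ∀ (n : ℕ) (x : Gm m), μ (cylAt m n x) = (M m n : ℝ≥0∞)⁻¹

/-- A martingale with respect to the filtration `(ℱ_n)` on `G_m`, where `ℱ_n` is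
generated by the first `n` coordinates: each `f n` is integrable and depends only
on the first `n` coordinates, and the conditional expectation of `f N` with
respect to `ℱ_n` (which under the Haar measure is given by averaging over the
cylinders of length `n`) equals `f n` for `n ≤ N`. -/
structure IsMartingale (μ : Measure (Gm m)) (f : ℕ → Gm m → ℂ) : Prop where
  integrable : ∀ n, Integrable (f n) μ
  adapted : ∀ (n : ℕ) (x y : Gm m), (∀ k < n, x k = y k) → f n x = f n y
  mart : ∀ n N : ℕ, n ≤ N → ∀ x : Gm m,
    f n x = (M m n : ℂ) * ∫ t in cylAt m n x, f N t ∂μ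

/-- The Vilenkin–Fourier coefficients of a martingale:
`f̂(i) = lim_k ∫ f^(k) conj(ψ_i) dμ`; for a martingale these integrals are
constant as soon as `M_k > i`, in particular from `k = i + 1` on. -/
def coeff (μ : Measure (Gm m)) (f : ℕ → Gm m → ℂ) (i : ℕ) : ℂ :=
  ∫ x, f (i + 1) x * (starRingEnd ℂ) (vil m i x) ∂μ

/-- The partial sums `S_n f = ∑_{k=0}^{n-1} f̂(k) ψ_k`. -/
def S (μ : Measure (Gm m)) (f : ℕ → Gm m → ℂ) (n : ℕ) (x : Gm m) : ℂ :=
  ∑ k ∈ Finset.range n, coeff m μ f k * vil m k x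

/-- The Fejér means `σ_n f = (1/n) ∑_{k=1}^{n} S_k f`. -/
def sigma (μ : Measure (Gm m)) (f : ℕ → Gm m → ℂ) (n : ℕ) (x : Gm m) : ℂ :=
  (n : ℂ)⁻¹ * ∑ k ∈ Finset.range n, S m μ f (k + 1) x

/-- The Nörlund means `t_n f = (1/Q_n) ∑_{k=1}^{n} q_{n-k} S_k f`. -/
def T (μ : Measure (Gm m)) (q : ℕ → ℝ) (f : ℕ → Gm m → ℂ) (n : ℕ) (x : Gm m) : ℂ :=
  ((∑ k ∈ Finset.range n, q k : ℝ) : ℂ)⁻¹ *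
    ∑ k ∈ Finset.range n, (q (n - (k + 1)) : ℂ) * S m μ f (k + 1) x

/-- The martingale maximal function `f* = sup_n |f^(n)|`. -/
def mstar (f : ℕ → Gm m → ℂ) (x : Gm m) : ℝ≥0∞ := ⨆ n, (‖f n x‖₊ : ℝ≥0∞)

/-- The `L_p`-type quasi-norm `(∫ g^p dμ)^{1/p}` of an `ℝ≥0∞`-valued function. -/
def eLp (μ : Measure (Gm m)) (p : ℝ) (g : Gm m → ℝ≥0∞) : ℝ≥0∞ :=
  (∫⁻ x, g x ^ p ∂μ) ^ (1 / p)

/-- Membership in the martingale Hardy space `H_p`: `‖f‖_{H_p} = ‖f*‖_{L_p} < ∞`. -/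
def MemHp (μ : Measure (Gm m)) (p : ℝ) (f : ℕ → Gm m → ℂ) : Prop :=
  eLp m μ p (mstar m f) ≠ ⊤

/-- The weak-`L_p` quasi-norm `sup_{t>0} t · μ(g > t)^{1/p}`. -/
def wLp (μ : Measure (Gm m)) (p : ℝ) (g : Gm m → ℝ≥0∞) : ℝ≥0∞ :=
  ⨆ t : ℝ≥0, (t : ℝ≥0∞) * μ {x | (t : ℝ≥0∞) < g x} ^ (1 / p)

end Vilenkin

namespace Vilenkin

section Digits

variable {m : ℕ → ℕ}

theorem M_succ (k : ℕ) : M m (k + 1) = m k * M m k := rfl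

theorem M_pos (hm : ∀ k, 2 ≤ m k) (k : ℕ) : 0 < M m k := by
  induction k with
  | zero => exact Nat.one_pos
  | succ k ih => exact Nat.mul_pos (lt_of_lt_of_le Nat.two_pos (hm k)) ih

theorem two_mul_M_le (hm : ∀ k, 2 ≤ m k) (k : ℕ) : 2 * M m k ≤ M m (k + 1) :=
  Nat.mul_le_mul_right _ (hm k)

theorem two_pow_mul_M_le (hm : ∀ k, 2 ≤ m k) (k d : ℕ) : 2 ^ d * M m k ≤ M m (k + d) := by
  induction d with
  | zero => simp
  | succ d ih =>
    calc 2 ^ (d + 1) * M m k = 2 * (2 ^ d * M m k) := by ring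
      _ ≤ 2 * M m (k + d) := Nat.mul_le_mul_left _ ih
      _ ≤ M m (k + (d + 1)) := two_mul_M_le hm (k + d)

theorem M_mono (hm : ∀ k, 2 ≤ m k) : Monotone (M m) :=
  monotone_nat_of_le_succ fun k => by
    have := two_mul_M_le hm k
    omega

theorem lt_M (hm : ∀ k, 2 ≤ m k) (k : ℕ) : k < M m k := by
  have h := two_pow_mul_M_le hm 0 k
  simp only [M, mul_one, zero_add] at h
  exact lt_of_lt_of_le Nat.lt_two_pow_self h

theorem M_dvd {s j : ℕ} (h : s ≤ j) : M m s ∣ M m j := by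
  induction j, h using Nat.le_induction with
  | base => exact dvd_rfl
  | succ j _ ih => exact ih.trans (Dvd.intro_left _ rfl)

theorem digit_eq_zero {n j : ℕ} (h : n < M m j) : digit m n j = 0 := by
  simp [digit, Nat.div_eq_of_lt h]

theorem digit_mul_add_of_lt (hm : ∀ k, 2 ≤ m k) {a b s j : ℕ} (h : s < j) :
    digit m (a * M m j + b) s = digit m b s := by
  obtain ⟨c, hc⟩ := M_dvd (m := m) (Nat.succ_le_of_lt h)
  have e : a * M m j + b = b + M m s * (m s * (a * c)) := by
    rw [hc, Nat.succ_eq_add_one, M_succ]; ring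
  rw [digit, e, Nat.add_mul_div_left _ _ (M_pos hm s), Nat.add_mul_mod_self_left, digit]

theorem digit_mul_add_self (hm : ∀ k, 2 ≤ m k) {a b j : ℕ} (ha : a < m j) (hb : b < M m j) :
    digit m (a * M m j + b) j = a := by
  rw [digit, add_comm, Nat.add_mul_div_right _ _ (M_pos hm j), Nat.div_eq_of_lt hb, zero_add,
    Nat.mod_eq_of_lt ha]

end Digits

section Kernel

variable {m : ℕ → ℕ} {z : ℕ → ℂ}

/-- The Vilenkin function `ψ_n` with the values of the Rademacher functions replaced by `z`. -/
def charVal (m : ℕ → ℕ) (z : ℕ → ℂ) (n : ℕ) : ℂ :=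
  ∏ k ∈ Finset.range (n + 1), z k ^ digit m n k

/-- The Dirichlet sums of `charVal`. -/
def dirSum (m : ℕ → ℕ) (z : ℕ → ℂ) (n : ℕ) : ℂ := ∑ i ∈ Finset.range n, charVal m z i

/-- The unnormalized Fejér sums of `charVal`. -/
def fejSum (m : ℕ → ℕ) (z : ℕ → ℂ) (n : ℕ) : ℂ := ∑ k ∈ Finset.range n, dirSum m z (k + 1)

theorem charVal_eq_prod (hm : ∀ k, 2 ≤ m k) {n S : ℕ} (h : n < M m S) :
    charVal m z n = ∏ k ∈ Finset.range S, z k ^ digit m n k := by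
  have aux : ∀ {A B : ℕ}, n < M m A → A ≤ B →
      ∏ k ∈ Finset.range A, z k ^ digit m n k = ∏ k ∈ Finset.range B, z k ^ digit m n k := by
    intro A B hA hAB
    refine Finset.prod_subset (Finset.range_mono hAB) fun k _ hk => ?_
    rw [digit_eq_zero (hA.trans_le (M_mono hm (by simpa using hk))), pow_zero]
  have h1 : n < M m (n + 1) := (Nat.lt_succ_self n).trans (lt_M hm (n + 1))
  rcases le_total S (n + 1) with hS | hS
  · exact (aux h hS).symm
  · exact aux h1 hS

theorem charVal_mul_add (hm : ∀ k, 2 ≤ m k) {a b j : ℕ} (ha : a < m j) (hb : b < M m j) :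
    charVal m z (a * M m j + b) = z j ^ a * charVal m z b := by
  have hlt : a * M m j + b < M m (j + 1) := by
    rw [M_succ]; nlinarith
  rw [charVal_eq_prod hm hlt, charVal_eq_prod hm hb, Finset.prod_range_succ,
    digit_mul_add_self hm ha hb, mul_comm]
  congr 1
  refine Finset.prod_congr rfl fun s hs => ?_
  rw [digit_mul_add_of_lt hm (Finset.mem_range.1 hs)]

theorem dirSum_mul_add (hm : ∀ k, 2 ≤ m k) {a b j : ℕ} (ha : a < m j) (hb : b ≤ M m j) :
    dirSum m z (a * M m j + b) = dirSum m z (a * M m j) + z j ^ a * dirSum m z b := by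
  rw [dirSum, Finset.sum_range_add, dirSum, dirSum, Finset.mul_sum]
  congr 1
  exact Finset.sum_congr rfl fun i hi =>
    charVal_mul_add hm ha ((Finset.mem_range.1 hi).trans_le hb)

theorem dirSum_mul (hm : ∀ k, 2 ≤ m k) {a j : ℕ} (ha : a ≤ m j) :
    dirSum m z (a * M m j) = (∑ u ∈ Finset.range a, z j ^ u) * dirSum m z (M m j) := by
  induction a with
  | zero => simp [dirSum]
  | succ a ih =>
    rw [add_mul, one_mul, dirSum_mul_add hm ha le_rfl, ih (by omega), Finset.sum_range_succ,
      add_mul]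

theorem fejSum_mul_add (hm : ∀ k, 2 ≤ m k) {a b j : ℕ} (ha : a < m j) (hb : b ≤ M m j) :
    fejSum m z (a * M m j + b) =
      fejSum m z (a * M m j) + b * dirSum m z (a * M m j) + z j ^ a * fejSum m z b := by
  rw [fejSum, Finset.sum_range_add, ← fejSum, add_assoc, fejSum, fejSum, Finset.mul_sum]
  congr 1
  have : ∀ k ∈ Finset.range b, dirSum m z (a * M m j + k + 1) =
      dirSum m z (a * M m j) + z j ^ a * dirSum m z (k + 1) := fun k hk => by
    rw [add_assoc, dirSum_mul_add hm ha]
    have := Finset.mem_range.1 hk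
    omega
  rw [Finset.sum_congr rfl this, Finset.sum_add_distrib]
  simp

theorem norm_geom_le (hz : ∀ k, ‖z k‖ = 1) (j a : ℕ) : ‖∑ u ∈ Finset.range a, z j ^ u‖ ≤ a := by
  refine (norm_sum_le _ _).trans ?_
  simp [hz]

theorem geom_eq_zero (hmz : ∀ k, z k ^ m k = 1) {j : ℕ} (h : z j ≠ 1) :
    ∑ u ∈ Finset.range (m j), z j ^ u = 0 := by
  rw [geom_sum_eq h, hmz, sub_self, zero_div]

theorem norm_fejSum_mul_sub_le (hm : ∀ k, 2 ≤ m k) (hz : ∀ k, ‖z k‖ = 1) {a j : ℕ}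
    (ha : a ≤ m j) :
    ‖fejSum m z (a * M m j) - (∑ u ∈ Finset.range a, z j ^ u) * fejSum m z (M m j)‖ ≤
      (a : ℝ) ^ 2 * (M m j * ‖dirSum m z (M m j)‖) := by
  induction a with
  | zero => simp [fejSum]
  | succ a ih =>
    have e : fejSum m z ((a + 1) * M m j) -
        (∑ u ∈ Finset.range (a + 1), z j ^ u) * fejSum m z (M m j) =
        (fejSum m z (a * M m j) - (∑ u ∈ Finset.range a, z j ^ u) * fejSum m z (M m j)) +
          M m j * ((∑ u ∈ Finset.range a, z j ^ u) * dirSum m z (M m j)) := by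
      rw [add_mul, one_mul, fejSum_mul_add hm ha le_rfl, dirSum_mul hm (by omega),
        Finset.sum_range_succ]
      ring
    rw [e]
    refine (norm_add_le _ _).trans ?_
    have h1 := ih (by omega)
    have h2 : ‖(M m j : ℂ) * ((∑ u ∈ Finset.range a, z j ^ u) * dirSum m z (M m j))‖ ≤
        a * (M m j * ‖dirSum m z (M m j)‖) := by
      rw [norm_mul, norm_mul, Complex.norm_natCast, mul_left_comm]
      exact mul_le_mul_of_nonneg_right (norm_geom_le hz j a) (by positivity)
    have h3 : (0 : ℝ) ≤ M m j * ‖dirSum m z (M m j)‖ := by positivity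
    push_cast
    nlinarith [mul_nonneg (Nat.cast_nonneg (α := ℝ) a) h3]

open Classical in
/-- The indicator of `z s = 1` for all `s < j` different from `i`. -/
def trivInd (z : ℕ → ℂ) (i j : ℕ) : ℝ := if ∀ s < j, s ≠ i → z s = 1 then 1 else 0

theorem trivInd_nonneg (i j : ℕ) : 0 ≤ trivInd z i j := by
  unfold trivInd; split_ifs <;> norm_num

/-- The positive majorant of the Fejér sums of order `M_j`. -/
def majorant (m : ℕ → ℕ) (z : ℕ → ℂ) (j : ℕ) : ℝ :=
  ∑ i ∈ Finset.range (j + 1), (M m i : ℝ) * M m j * trivInd z i j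

theorem majorant_term_nonneg (i j : ℕ) : 0 ≤ (M m i : ℝ) * M m j * trivInd z i j :=
  mul_nonneg (by positivity) (trivInd_nonneg i j)

theorem majorant_nonneg (j : ℕ) : 0 ≤ majorant m z j :=
  Finset.sum_nonneg fun _ _ => majorant_term_nonneg _ _

theorem norm_dirSum_M_le (hm : ∀ k, 2 ≤ m k) (hz : ∀ k, ‖z k‖ = 1)
    (hmz : ∀ k, z k ^ m k = 1) (j : ℕ) :
    ‖dirSum m z (M m j)‖ ≤ M m j * trivInd z j j := by
  induction j with
  | zero => simp [dirSum, M, trivInd, charVal, digit]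
  | succ j ih =>
    rw [M_succ, dirSum_mul hm le_rfl, norm_mul]
    by_cases h : z j = 1
    · have : trivInd z (j + 1) (j + 1) = trivInd z j j := by
        unfold trivInd
        congr 1
        refine propext ⟨fun H s hs _ => H s (by omega) (by omega), fun H s hs _ => ?_⟩
        rcases Nat.lt_succ_iff_lt_or_eq.1 hs with h' | rfl
        · exact H s h' h'.ne
        · exact h
      rw [this]
      calc _ ≤ (m j : ℝ) * (M m j * trivInd z j j) :=
            mul_le_mul (norm_geom_le hz j _) ih (norm_nonneg _) (by positivity)
        _ = _ := by push_cast; ring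
    · rw [geom_eq_zero hmz h, norm_zero, zero_mul]
      exact mul_nonneg (by positivity) (trivInd_nonneg _ _)

theorem M_mul_norm_dirSum_le (hm : ∀ k, 2 ≤ m k) (hz : ∀ k, ‖z k‖ = 1)
    (hmz : ∀ k, z k ^ m k = 1) (j : ℕ) :
    (M m j : ℝ) * ‖dirSum m z (M m j)‖ ≤ M m j * M m j * trivInd z j j := by
  rw [mul_assoc]
  exact mul_le_mul_of_nonneg_left (norm_dirSum_M_le hm hz hmz j) (by positivity)

theorem trivInd_succ_self (j : ℕ) : trivInd z j (j + 1) = trivInd z j j := by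
  unfold trivInd
  congr 1
  refine propext ⟨fun H s hs hne => H s (by omega) hne, fun H s hs hne => H s (by omega) hne⟩

theorem trivInd_succ_of_eq_one {i j : ℕ} (h : z j = 1) : trivInd z i (j + 1) = trivInd z i j := by
  unfold trivInd
  congr 1
  refine propext ⟨fun H s hs hne => H s (by omega) hne, fun H s hs hne => ?_⟩
  rcases Nat.lt_succ_iff_lt_or_eq.1 hs with h' | rfl
  · exact H s h' hne
  · exact h

theorem trivInd_succ_succ_of_eq_one {j : ℕ} (h : z j = 1) :
    trivInd z (j + 1) (j + 1) = trivInd z j j := by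
  unfold trivInd
  congr 1
  refine propext ⟨fun H s hs _ => H s (by omega) (by omega), fun H s hs _ => ?_⟩
  rcases Nat.lt_succ_iff_lt_or_eq.1 hs with h' | rfl
  · exact H s h' h'.ne
  · exact h

theorem norm_fejSum_M_le {lam : ℕ} (hm : ∀ k, 2 ≤ m k) (hlam : ∀ k, m k ≤ lam)
    (hz : ∀ k, ‖z k‖ = 1) (hmz : ∀ k, z k ^ m k = 1) (j : ℕ) :
    ‖fejSum m z (M m j)‖ ≤ (lam : ℝ) ^ 2 * majorant m z j := by
  have hl : (1 : ℝ) ≤ lam := by exact_mod_cast (le_trans (by norm_num) (hm 0)).trans (hlam 0)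
  induction j with
  | zero =>
    simp only [fejSum, M, dirSum, charVal, digit, majorant, trivInd]
    have : 1 ≤ lam := by exact_mod_cast hl
    simpa [M] using this
  | succ j ih =>
    have h1 := norm_fejSum_mul_sub_le hm hz (le_refl (m j))
    have h2 := M_mul_norm_dirSum_le hm hz hmz j
    have hmj : ((m j : ℕ) : ℝ) ≤ lam := by exact_mod_cast hlam j
    have hm1 : (1 : ℝ) ≤ m j := by exact_mod_cast (le_trans (by norm_num) (hm j))
    have hsq : (m j : ℝ) ^ 2 ≤ (lam : ℝ) ^ 2 := by gcongr
    have t0 := trivInd_nonneg (z := z) j j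
    have h3 : ((m j : ℕ) : ℝ) ^ 2 * (M m j * ‖dirSum m z (M m j)‖) ≤
        (lam : ℝ) ^ 2 * (M m j * M m (j + 1) * trivInd z j (j + 1)) := by
      refine mul_le_mul hsq (h2.trans ?_) (by positivity) (by positivity)
      rw [trivInd_succ_self]
      refine mul_le_mul_of_nonneg_right ?_ t0
      exact mul_le_mul_of_nonneg_left (by exact_mod_cast M_mono hm (Nat.le_succ j)) (by positivity)
    have hM : M m (j + 1) = m j * M m j := rfl
    rw [← hM] at h1
    have e : majorant m z (j + 1) =
        (∑ i ∈ Finset.range j, (M m i : ℝ) * M m (j + 1) * trivInd z i (j + 1)) +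
          (M m j : ℝ) * M m (j + 1) * trivInd z j (j + 1) +
          (M m (j + 1) : ℝ) * M m (j + 1) * trivInd z (j + 1) (j + 1) := by
      rw [majorant, Finset.sum_range_succ, Finset.sum_range_succ]
    have n1 : 0 ≤ ∑ i ∈ Finset.range j, (M m i : ℝ) * M m (j + 1) * trivInd z i (j + 1) :=
      Finset.sum_nonneg fun _ _ => majorant_term_nonneg _ _
    have n3 := majorant_term_nonneg (m := m) (z := z) (j + 1) (j + 1)
    by_cases h : z j = 1
    · have e2 : (m j : ℝ) * majorant m z j ≤
          (∑ i ∈ Finset.range j, (M m i : ℝ) * M m (j + 1) * trivInd z i (j + 1)) +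
          (M m (j + 1) : ℝ) * M m (j + 1) * trivInd z (j + 1) (j + 1) := by
        rw [majorant, Finset.sum_range_succ, mul_add, Finset.mul_sum]
        refine add_le_add (le_of_eq (Finset.sum_congr rfl fun i _ => ?_)) ?_
        · rw [trivInd_succ_of_eq_one h, hM]; push_cast; ring
        · rw [trivInd_succ_succ_of_eq_one h, hM]
          push_cast
          have : (M m j : ℝ) * M m j * trivInd z j j ≤
              m j * (M m j * M m j * trivInd z j j) :=
            le_mul_of_one_le_left (mul_nonneg (by positivity) t0) hm1
          nlinarith
      have e3 : ‖(∑ u ∈ Finset.range (m j), z j ^ u) * fejSum m z (M m j)‖ ≤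
          (lam : ℝ) ^ 2 * (m j * majorant m z j) := by
        rw [norm_mul, mul_left_comm]
        exact mul_le_mul (norm_geom_le hz j _) ih (norm_nonneg _) (by positivity)
      have e4 := norm_le_norm_add_norm_sub' (fejSum m z (M m (j + 1)))
        ((∑ u ∈ Finset.range (m j), z j ^ u) * fejSum m z (M m j))
      have e5 := mul_le_mul_of_nonneg_left e2 (by positivity : (0 : ℝ) ≤ (lam : ℝ) ^ 2)
      rw [e]
      nlinarith
    · rw [geom_eq_zero hmz h, zero_mul, sub_zero] at h1
      refine (h1.trans h3).trans (mul_le_mul_of_nonneg_left ?_ (by positivity))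
      rw [e]
      linarith

theorem norm_fejSum_le {lam : ℕ} (hm : ∀ k, 2 ≤ m k) (hlam : ∀ k, m k ≤ lam)
    (hz : ∀ k, ‖z k‖ = 1) (hmz : ∀ k, z k ^ m k = 1) {n J : ℕ} (hn : n < M m J) :
    ‖fejSum m z n‖ ≤ 3 * (lam : ℝ) ^ 3 * ∑ j ∈ Finset.range J, majorant m z j := by
  induction J generalizing n with
  | zero =>
    have : n = 0 := by simpa [M] using hn
    simp [this, fejSum]
  | succ J ih =>
    have hpos := M_pos hm J
    obtain ⟨a, b, hb, hn'⟩ : ∃ a b, b < M m J ∧ n = a * M m J + b :=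
      ⟨n / M m J, n % M m J, Nat.mod_lt _ hpos, (Nat.div_add_mod' n _).symm⟩
    have ha : a < m J := by
      rw [M_succ] at hn
      by_contra! h
      have := Nat.mul_le_mul_right (M m J) h
      omega
    subst hn'
    rw [Finset.sum_range_succ, mul_add]
    have h0 := ih hb
    have hl : (1 : ℝ) ≤ lam := by exact_mod_cast (le_trans (by norm_num) (hm 0)).trans (hlam 0)
    have hal : (a : ℝ) ≤ lam := by exact_mod_cast ha.le.trans (hlam J)
    have h1 := norm_fejSum_mul_sub_le hm hz ha.le
    have h2 : (M m J : ℝ) * ‖dirSum m z (M m J)‖ ≤ majorant m z J := by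
      refine (M_mul_norm_dirSum_le hm hz hmz J).trans ?_
      exact Finset.single_le_sum (f := fun i => (M m i : ℝ) * M m J * trivInd z i J)
        (fun _ _ => majorant_term_nonneg _ _) (Finset.self_mem_range_succ J)
    have h3 := norm_fejSum_M_le hm hlam hz hmz J
    have hH := majorant_nonneg (m := m) (z := z) J
    have e1 : ‖(∑ u ∈ Finset.range a, z J ^ u) * fejSum m z (M m J)‖ ≤
        lam * ((lam : ℝ) ^ 2 * majorant m z J) := by
      rw [norm_mul]
      exact mul_le_mul ((norm_geom_le hz J a).trans hal) h3 (norm_nonneg _) (by positivity)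
    have e2 := norm_le_norm_add_norm_sub' (fejSum m z (a * M m J))
      ((∑ u ∈ Finset.range a, z J ^ u) * fejSum m z (M m J))
    have e3 : ‖(b : ℂ) * dirSum m z (a * M m J)‖ ≤ lam * majorant m z J := by
      rw [dirSum_mul hm ha.le, norm_mul, norm_mul, Complex.norm_natCast, mul_left_comm]
      refine mul_le_mul ((norm_geom_le hz J a).trans hal) (le_trans ?_ h2) (by positivity)
        (by positivity)
      gcongr
    have e4 : (a : ℝ) ^ 2 * (M m J * ‖dirSum m z (M m J)‖) ≤ (lam : ℝ) ^ 2 * majorant m z J := by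
      gcongr
    have e5 : ‖z J ^ a * fejSum m z b‖ = ‖fejSum m z b‖ := by simp [hz]
    rw [fejSum_mul_add hm ha hb.le]
    have e6 := norm_add₃_le (a := fejSum m z (a * M m J))
      (b := (b : ℂ) * dirSum m z (a * M m J)) (c := z J ^ a * fejSum m z b)
    have l2 : (lam : ℝ) ≤ (lam : ℝ) ^ 3 := le_self_pow₀ hl (by norm_num)
    have l3 : (lam : ℝ) ^ 2 ≤ (lam : ℝ) ^ 3 := pow_le_pow_right₀ hl (by norm_num)
    have l4 := mul_le_mul_of_nonneg_right l2 hH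
    have l5 := mul_le_mul_of_nonneg_right l3 hH
    nlinarith

end Kernel

section Cylinders

variable {m : ℕ → ℕ}

/-- Replace all coordinates from `A` on by zero. -/
def trunc (A : ℕ) (x : Gm m) : Gm m := fun k => if k < A then x k else 0

theorem trunc_of_lt {A k : ℕ} (x : Gm m) (h : k < A) : trunc A x k = x k := if_pos h

theorem mem_cylAt_self (A : ℕ) (x : Gm m) : x ∈ cylAt m A x := fun _ _ => rfl

theorem cylAt_eq_of_mem {A : ℕ} {x y : Gm m} (h : y ∈ cylAt m A x) :
    cylAt m A y = cylAt m A x :=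
  Set.ext fun _ => ⟨fun H k hk => (H k hk).trans (h k hk),
    fun H k hk => (H k hk).trans (h k hk).symm⟩

theorem cylAt_anti {A B : ℕ} (h : A ≤ B) (x : Gm m) : cylAt m B x ⊆ cylAt m A x :=
  fun _ H k hk => H k (hk.trans_le h)

theorem cylAt_zero (x : Gm m) : cylAt m 0 x = Set.univ :=
  Set.eq_univ_of_forall fun _ _ hk => absurd hk (Nat.not_lt_zero _)

theorem mem_cylAt_trunc (A : ℕ) (x : Gm m) : x ∈ cylAt m A (trunc A x) :=
  fun _ hk => (trunc_of_lt x hk).symm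

theorem dependsOn_eq_trunc {β : Type*} {A : ℕ} {φ : Gm m → β} (h : DependsOn φ (Set.Iio A))
    (x : Gm m) : φ x = φ (trunc A x) :=
  h fun _ hk => (trunc_of_lt x hk).symm

theorem measurableSet_cylAt (A : ℕ) (x : Gm m) : MeasurableSet (cylAt m A x) := by
  have : cylAt m A x = ⋂ k ∈ Set.Iio A, (fun y : Gm m => y k) ⁻¹' {x k} := by
    ext y; simp [cylAt]
  rw [this]
  exact MeasurableSet.biInter (Set.to_countable _) fun k _ =>
    measurable_pi_apply k MeasurableSpace.measurableSet_top

variable [∀ k, NeZero (m k)]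

theorem finite_range_trunc (A : ℕ) : (Set.range (trunc (m := m) A)).Finite := by
  have : Set.range (trunc (m := m) A) ⊆ Set.range
      (fun (v : ∀ k : Fin A, ZMod (m k)) (k : ℕ) => if h : k < A then v ⟨k, h⟩ else 0) := by
    rintro _ ⟨x, rfl⟩
    refine ⟨fun k => x k, funext fun k => ?_⟩
    by_cases h : k < A <;> simp [trunc, h]
  exact (Set.finite_range _).subset this

/-- Representatives of the cylinders of length `A`. -/
def reps (m : ℕ → ℕ) [∀ k, NeZero (m k)] (A : ℕ) : Finset (Gm m) :=
  (finite_range_trunc A).toFinset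

theorem trunc_mem_reps (A : ℕ) (x : Gm m) : trunc A x ∈ reps m A := by simp [reps]

theorem eq_trunc_of_mem_reps {A : ℕ} {u x : Gm m} (hu : u ∈ reps m A) (h : x ∈ cylAt m A u) :
    u = trunc A x := by
  obtain ⟨y, rfl⟩ : ∃ y, trunc A y = u := by simpa [reps] using hu
  funext k
  by_cases hk : k < A
  · rw [trunc_of_lt x hk, h k hk]
  · simp [trunc, hk]

theorem biUnion_reps (A : ℕ) : ⋃ u ∈ reps m A, cylAt m A u = Set.univ :=
  Set.eq_univ_of_forall fun x =>
    Set.mem_biUnion (trunc_mem_reps A x) (mem_cylAt_trunc A x)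

theorem pairwiseDisjoint_reps (A : ℕ) :
    (↑(reps m A) : Set (Gm m)).PairwiseDisjoint (cylAt m A) := by
  intro u hu v hv huv
  refine Set.disjoint_left.2 fun x hx hx' => huv ?_
  rw [eq_trunc_of_mem_reps hu hx, eq_trunc_of_mem_reps hv hx']

theorem finite_range_of_dependsOn {β : Type*} {A : ℕ} {φ : Gm m → β}
    (h : DependsOn φ (Set.Iio A)) : (Set.range φ).Finite := by
  refine ((finite_range_trunc (m := m) A).image φ).subset ?_
  rintro _ ⟨x, rfl⟩
  exact ⟨trunc A x, ⟨x, rfl⟩, (dependsOn_eq_trunc h x).symm⟩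

theorem measurableSet_of_dependsOn {A : ℕ} {s : Set (Gm m)}
    (h : DependsOn (· ∈ s) (Set.Iio A)) : MeasurableSet s := by
  have : s = ⋃ u ∈ (↑(reps m A) ∩ s : Set (Gm m)), cylAt m A u := by
    ext x
    simp only [Set.mem_iUnion, exists_prop]
    constructor
    · intro hx
      refine ⟨trunc A x, ⟨trunc_mem_reps A x, ?_⟩, mem_cylAt_trunc A x⟩
      exact (dependsOn_eq_trunc h x).mp hx
    · rintro ⟨u, ⟨_, hu⟩, hx⟩
      exact (h (x := x) (y := u) fun k hk => hx k hk).mpr hu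
  rw [this]
  exact MeasurableSet.biUnion (((reps m A).finite_toSet.inter_of_left s).countable)
    fun u _ => measurableSet_cylAt A u

theorem measurable_of_dependsOn {β : Type*} [MeasurableSpace β] {A : ℕ} {φ : Gm m → β}
    (h : DependsOn φ (Set.Iio A)) : Measurable φ := fun s _ =>
  measurableSet_of_dependsOn (A := A) fun x y hxy => by
    simp only [Set.mem_preimage, h hxy]

theorem exists_bound_of_dependsOn {A : ℕ} {φ : Gm m → ℂ} (h : DependsOn φ (Set.Iio A)) :
    ∃ B : ℝ, ∀ x, ‖φ x‖ ≤ B := by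
  have := (finite_range_of_dependsOn (A := A) (φ := fun x => ‖φ x‖) fun x y hxy => by
    simp only [h hxy]).bddAbove
  obtain ⟨B, hB⟩ := this
  exact ⟨B, fun x => hB ⟨x, rfl⟩⟩

variable {μ : Measure (Gm m)}

theorem integrable_of_dependsOn [IsFiniteMeasure μ] {A : ℕ} {φ : Gm m → ℂ}
    (h : DependsOn φ (Set.Iio A)) : Integrable φ μ := by
  obtain ⟨B, hB⟩ := exists_bound_of_dependsOn h
  exact Integrable.of_bound (measurable_of_dependsOn h).aestronglyMeasurable B (ae_of_all _ hB)

theorem setIntegral_eq_sum_reps (A : ℕ) {s : Set (Gm m)} (hs : MeasurableSet s) {φ : Gm m → ℂ}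
    (h : Integrable φ μ) :
    ∫ x in s, φ x ∂μ = ∑ u ∈ reps m A, ∫ x in cylAt m A u ∩ s, φ x ∂μ := by
  rw [← integral_biUnion_finset]
  · rw [← Set.iUnion₂_inter, biUnion_reps, Set.univ_inter]
  · exact fun u _ => (measurableSet_cylAt A u).inter hs
  · exact fun u hu v hv huv =>
      (pairwiseDisjoint_reps A hu hv huv).mono Set.inter_subset_left Set.inter_subset_left
  · exact fun u _ => h.integrableOn

theorem integral_eq_sum_reps (A : ℕ) {φ : Gm m → ℂ} (h : Integrable φ μ) :
    ∫ x, φ x ∂μ = ∑ u ∈ reps m A, ∫ x in cylAt m A u, φ x ∂μ := by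
  simpa using setIntegral_eq_sum_reps A MeasurableSet.univ h

end Cylinders

section Haar

variable {m : ℕ → ℕ} {μ : Measure (Gm m)}

theorem IsHaar.isProbabilityMeasure (hμ : IsHaar m μ) : IsProbabilityMeasure μ :=
  ⟨by simpa [cylAt_zero, M] using hμ 0 0⟩

theorem IsHaar.real_cylAt (hμ : IsHaar m μ) (n : ℕ) (x : Gm m) :
    μ.real (cylAt m n x) = (M m n : ℝ)⁻¹ := by
  rw [measureReal_def, hμ, ENNReal.toReal_inv, ENNReal.toReal_natCast]

/-- The points agreeing with `x` in all coordinates below `j`, except possibly the `i`-th. -/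
def agree (i j : ℕ) (x : Gm m) : Set (Gm m) := {t | ∀ s < j, s ≠ i → t s = x s}

theorem agree_comm {i j : ℕ} {x t : Gm m} : t ∈ agree i j x ↔ x ∈ agree i j t :=
  ⟨fun h s hs hne => (h s hs hne).symm, fun h s hs hne => (h s hs hne).symm⟩

theorem measurableSet_agree [∀ k, NeZero (m k)] (i j : ℕ) (x : Gm m) :
    MeasurableSet (agree i j x) :=
  measurableSet_of_dependsOn (A := j) fun _ _ h =>
    propext ⟨fun H s hs hne => (h s hs).symm.trans (H s hs hne),
      fun H s hs hne => (h s hs).trans (H s hs hne)⟩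

theorem IsHaar.real_agree_le [∀ k, NeZero (m k)] {lam : ℕ} (hlam : ∀ k, m k ≤ lam)
    (hμ : IsHaar m μ) (i j : ℕ) (x : Gm m) :
    μ.real (agree i j x) ≤ lam * (M m j : ℝ)⁻¹ := by
  have := hμ.isProbabilityMeasure
  have hsub : agree i j x ⊆ ⋃ c ∈ (Finset.univ : Finset (ZMod (m i))),
      cylAt m j (Function.update x i c) := by
    intro t ht
    refine Set.mem_biUnion (x := t i) (by simp) fun k hk => ?_
    by_cases h : k = i
    · subst h; simp
    · rw [Function.update_of_ne h]; exact ht k hk h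
  refine (measureReal_mono hsub (measure_ne_top _ _)).trans
    ((measureReal_biUnion_finset_le _ _).trans ?_)
  simp only [hμ.real_cylAt, Finset.sum_const, nsmul_eq_mul, Finset.card_univ, ZMod.card]
  exact mul_le_mul_of_nonneg_right (by exact_mod_cast hlam i) (by positivity)

open Classical in
/-- The indicator of `agree i j u`. -/
def agrInd (i j : ℕ) (u x : Gm m) : ℝ := if x ∈ agree i j u then 1 else 0

theorem agrInd_nonneg (i j : ℕ) (u x : Gm m) : 0 ≤ agrInd i j u x := by
  unfold agrInd; split_ifs <;> norm_num

theorem agrInd_eq_indicator (i j : ℕ) (u : Gm m) :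
    agrInd i j u = (agree i j u).indicator 1 := by
  ext x; simp [agrInd, Set.indicator]

theorem integrable_agrInd [∀ k, NeZero (m k)] [IsFiniteMeasure μ] (i j : ℕ) (u : Gm m) :
    Integrable (agrInd i j u) μ := by
  rw [agrInd_eq_indicator]
  exact (integrable_const (1 : ℝ)).indicator (measurableSet_agree i j u)

theorem integral_agrInd [∀ k, NeZero (m k)] (i j : ℕ) (u : Gm m) :
    ∫ x, agrInd i j u x ∂μ = μ.real (agree i j u) := by
  rw [agrInd_eq_indicator, integral_indicator_one (measurableSet_agree i j u)]

theorem setIntegral_agrInd [∀ k, NeZero (m k)] (i j : ℕ) (u : Gm m) (s : Set (Gm m)) :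
    ∫ x in s, agrInd i j u x ∂μ = μ.real (s ∩ agree i j u) := by
  rw [integral_agrInd, measureReal_restrict_apply (measurableSet_agree i j u), Set.inter_comm]

/-- The terms of level `j` of the majorant kernel around `u`. -/
def kerLevel (j : ℕ) (u x : Gm m) : ℝ :=
  ∑ i ∈ Finset.range (j + 1), (M m i : ℝ) * M m j * agrInd i j u x

/-- The majorant kernel around `u`, truncated at level `A`. -/
def kerMaj (A : ℕ) (u x : Gm m) : ℝ := ∑ j ∈ Finset.range (A + 1), kerLevel j u x

theorem kerLevel_nonneg (j : ℕ) (u x : Gm m) : 0 ≤ kerLevel j u x :=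
  Finset.sum_nonneg fun i _ => mul_nonneg (by positivity) (agrInd_nonneg i j u x)

theorem kerMaj_nonneg (A : ℕ) (u x : Gm m) : 0 ≤ kerMaj A u x :=
  Finset.sum_nonneg fun j _ => kerLevel_nonneg j u x

theorem kerLevel_le_kerMaj {j A : ℕ} (h : j ≤ A) (u x : Gm m) : kerLevel j u x ≤ kerMaj A u x :=
  Finset.single_le_sum (f := fun j => kerLevel j u x) (fun j _ => kerLevel_nonneg j u x)
    (Finset.mem_range.2 (Nat.lt_succ_of_le h))

theorem sum_M_le (hm : ∀ k, 2 ≤ m k) (j : ℕ) :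
    ∑ i ∈ Finset.range (j + 1), (M m i : ℝ) ≤ 2 * M m j := by
  induction j with
  | zero => simp [M]
  | succ j ih =>
    rw [Finset.sum_range_succ]
    have : (2 : ℝ) * M m j ≤ M m (j + 1) := by exact_mod_cast two_mul_M_le hm j
    linarith

section Local

variable {lam : ℕ}

theorem IsHaar.real_cylAt_inter_agree_of_le (hμ : IsHaar m μ) {i j A : ℕ} (h : j ≤ A)
    (u x : Gm m) : μ.real (cylAt m A u ∩ agree i j x) ≤ (M m A : ℝ)⁻¹ * agrInd i j u x := by
  have := hμ.isProbabilityMeasure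
  by_cases hx : x ∈ agree i j u
  · simp only [agrInd, hx, if_true, mul_one]
    exact (measureReal_mono Set.inter_subset_left).trans (hμ.real_cylAt A u).le
  · have : cylAt m A u ∩ agree i j x = ∅ := Set.eq_empty_of_forall_notMem fun t ht =>
      hx fun s hs hne => (ht.2 s hs hne).symm.trans (ht.1 s (hs.trans_le h))
    simp [this, agrInd, hx]

theorem IsHaar.real_cylAt_inter_agree_of_lt_of_lt (hμ : IsHaar m μ) {i j A : ℕ} (h : A < j)
    (hi : i < A) (u x : Gm m) :
    μ.real (cylAt m A u ∩ agree i j x) ≤ (M m j : ℝ)⁻¹ * agrInd i A u x := by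
  have := hμ.isProbabilityMeasure
  by_cases hx : x ∈ agree i A u
  · simp only [agrInd, hx, if_true, mul_one]
    rw [← hμ.real_cylAt j (fun s => if s < A then u s else x s)]
    refine measureReal_mono fun t ht s hs => ?_
    by_cases hsA : s < A
    · simpa [hsA] using ht.1 s hsA
    · simpa [hsA] using ht.2 s hs (by omega)
  · have : cylAt m A u ∩ agree i j x = ∅ := Set.eq_empty_of_forall_notMem fun t ht =>
      hx fun s hs hne => (ht.2 s (hs.trans h) hne).symm.trans (ht.1 s hs)
    simp [this, agrInd, hx]

theorem IsHaar.real_cylAt_inter_agree_of_lt_of_ge [∀ k, NeZero (m k)]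
    (hlam : ∀ k, m k ≤ lam) (hμ : IsHaar m μ) {i j A : ℕ} (h : A < j) (hi : A ≤ i) (u x : Gm m) :
    μ.real (cylAt m A u ∩ agree i j x) ≤ lam * (M m j : ℝ)⁻¹ * agrInd A A u x := by
  have := hμ.isProbabilityMeasure
  by_cases hx : x ∈ agree A A u
  · simp only [agrInd, hx, if_true, mul_one]
    exact (measureReal_mono Set.inter_subset_right).trans (hμ.real_agree_le hlam i j x)
  · have : cylAt m A u ∩ agree i j x = ∅ := Set.eq_empty_of_forall_notMem fun t ht =>
      hx fun s hs hne => (ht.2 s (hs.trans h) (by omega)).symm.trans (ht.1 s hs)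
    simp [this, agrInd, hx]

theorem IsHaar.sum_level_le_of_le (hμ : IsHaar m μ) {j A : ℕ} (h : j ≤ A)
    (u x : Gm m) :
    ∑ i ∈ Finset.range (j + 1), (M m i : ℝ) * M m j * μ.real (cylAt m A u ∩ agree i j x) ≤
      (M m A : ℝ)⁻¹ * kerLevel j u x := by
  rw [kerLevel, Finset.mul_sum]
  refine Finset.sum_le_sum fun i _ => ?_
  rw [mul_left_comm]
  exact mul_le_mul_of_nonneg_left (hμ.real_cylAt_inter_agree_of_le h u x) (by positivity)

theorem IsHaar.sum_level_le_of_lt [∀ k, NeZero (m k)] (hm : ∀ k, 2 ≤ m k) (hlam : ∀ k, m k ≤ lam)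
    (hμ : IsHaar m μ) {j A : ℕ} (h : A < j) (u x : Gm m) :
    ∑ i ∈ Finset.range (j + 1), (M m i : ℝ) * M m j * μ.real (cylAt m A u ∩ agree i j x) ≤
      ((M m A : ℝ) + 2 * lam * M m j) * ((M m A : ℝ)⁻¹ ^ 2 * kerMaj A u x) := by
  have hA : (0 : ℝ) < M m A := by exact_mod_cast M_pos hm A
  have hj : (0 : ℝ) < M m j := by exact_mod_cast M_pos hm j
  have hterm : ∀ i ∈ Finset.range (j + 1),
      (M m i : ℝ) * M m j * μ.real (cylAt m A u ∩ agree i j x) ≤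
        (if i < A then (M m i : ℝ) * agrInd i A u x else 0) +
          (M m i : ℝ) * (lam * agrInd A A u x) := by
    intro i _
    split_ifs with hi
    · have h1 := mul_le_mul_of_nonneg_left (hμ.real_cylAt_inter_agree_of_lt_of_lt h hi u x)
        (by positivity : (0 : ℝ) ≤ (M m i : ℝ) * M m j)
      have h2 : (0 : ℝ) ≤ (M m i : ℝ) * (lam * agrInd A A u x) :=
        mul_nonneg (by positivity) (mul_nonneg (by positivity) (agrInd_nonneg _ _ _ _))
      have e : (M m i : ℝ) * M m j * ((M m j : ℝ)⁻¹ * agrInd i A u x) =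
        M m i * agrInd i A u x := by field_simp
      linarith
    · have h1 := mul_le_mul_of_nonneg_left
        (hμ.real_cylAt_inter_agree_of_lt_of_ge hlam h (not_lt.1 hi) u x)
        (by positivity : (0 : ℝ) ≤ (M m i : ℝ) * M m j)
      have e : (M m i : ℝ) * M m j * (lam * (M m j : ℝ)⁻¹ * agrInd A A u x) =
        M m i * (lam * agrInd A A u x) := by field_simp
      linarith
  refine (Finset.sum_le_sum hterm).trans ?_
  rw [Finset.sum_add_distrib, ← Finset.sum_mul]
  have hAA : (M m A : ℝ) * M m A * agrInd A A u x ≤ kerMaj A u x :=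
    (Finset.single_le_sum (f := fun i => (M m i : ℝ) * M m A * agrInd i A u x)
      (fun i _ => mul_nonneg (by positivity) (agrInd_nonneg i A u x))
      (Finset.self_mem_range_succ A)).trans (kerLevel_le_kerMaj le_rfl u x)
  have h1 : ∑ i ∈ Finset.range (j + 1), (if i < A then (M m i : ℝ) * agrInd i A u x else 0) ≤
      (M m A : ℝ)⁻¹ * kerMaj A u x := by
    rw [← Finset.sum_filter]
    refine le_trans ?_ (mul_le_mul_of_nonneg_left (kerLevel_le_kerMaj le_rfl u x) (by positivity))
    rw [kerLevel, Finset.mul_sum]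
    have : ∀ i, (M m A : ℝ)⁻¹ * (M m i * M m A * agrInd i A u x) = M m i * agrInd i A u x :=
      fun i => by field_simp
    simp only [this]
    refine Finset.sum_le_sum_of_subset_of_nonneg ?_ fun i _ _ =>
      mul_nonneg (by positivity) (agrInd_nonneg i A u x)
    intro i hi
    simp only [Finset.mem_filter, Finset.mem_range] at hi ⊢
    omega
  have h2 : (∑ i ∈ Finset.range (j + 1), (M m i : ℝ)) * (lam * agrInd A A u x) ≤
      2 * M m j * (lam * ((M m A : ℝ)⁻¹ ^ 2 * kerMaj A u x)) := by
    have : agrInd A A u x ≤ (M m A : ℝ)⁻¹ ^ 2 * kerMaj A u x := by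
      calc agrInd A A u x = (M m A : ℝ)⁻¹ ^ 2 * (M m A * M m A * agrInd A A u x) := by field_simp
        _ ≤ _ := mul_le_mul_of_nonneg_left hAA (by positivity)
    have h0 := agrInd_nonneg A A u x
    exact mul_le_mul (sum_M_le hm j) (mul_le_mul_of_nonneg_left this (by positivity))
      (by positivity) (by positivity)
  have e : ((M m A : ℝ) + 2 * lam * M m j) * ((M m A : ℝ)⁻¹ ^ 2 * kerMaj A u x) =
      (M m A : ℝ)⁻¹ * kerMaj A u x +
        2 * M m j * (lam * ((M m A : ℝ)⁻¹ ^ 2 * kerMaj A u x)) := by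
    field_simp
  linarith

theorem IsHaar.sum_levels_le [∀ k, NeZero (m k)] (hm : ∀ k, 2 ≤ m k) (hlam : ∀ k, m k ≤ lam)
    (hμ : IsHaar m μ) {A J : ℕ} (h : A ≤ J) (u x : Gm m) :
    ∑ j ∈ Finset.range (J + 1), ∑ i ∈ Finset.range (j + 1),
      (M m i : ℝ) * M m j * μ.real (cylAt m A u ∩ agree i j x) ≤
      (1 + 4 * lam) * M m J * ((M m A : ℝ)⁻¹ ^ 2 * kerMaj A u x) := by
  have hA : (0 : ℝ) < M m A := by exact_mod_cast M_pos hm A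
  have hG : 0 ≤ (M m A : ℝ)⁻¹ ^ 2 * kerMaj A u x :=
    mul_nonneg (by positivity) (kerMaj_nonneg A u x)
  induction J, h using Nat.le_induction with
  | base =>
    calc _ ≤ ∑ j ∈ Finset.range (A + 1), (M m A : ℝ)⁻¹ * kerLevel j u x :=
          Finset.sum_le_sum fun j hj =>
            hμ.sum_level_le_of_le (Nat.lt_succ_iff.1 (Finset.mem_range.1 hj)) u x
      _ = 1 * M m A * ((M m A : ℝ)⁻¹ ^ 2 * kerMaj A u x) := by
          rw [← Finset.mul_sum, ← kerMaj]; field_simp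
      _ ≤ _ := by
          refine mul_le_mul_of_nonneg_right ?_ hG
          gcongr
          linarith [(Nat.cast_nonneg lam : (0 : ℝ) ≤ lam)]
  | succ J h ih =>
    rw [Finset.sum_range_succ]
    refine (add_le_add ih (hμ.sum_level_le_of_lt hm hlam (Nat.lt_succ_of_le h) u x)).trans ?_
    rw [← add_mul]
    refine mul_le_mul_of_nonneg_right ?_ hG
    have h1 : (2 : ℝ) * M m J ≤ M m (J + 1) := by exact_mod_cast two_mul_M_le hm J
    have h2 : (M m A : ℝ) ≤ M m J := by exact_mod_cast M_mono hm h
    have h3 : (0 : ℝ) ≤ lam := Nat.cast_nonneg lam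
    nlinarith [mul_le_mul_of_nonneg_left h1 h3]

end Local

end Haar

section PairKernel

variable {m : ℕ → ℕ}

/-- The values `r_s(x - t)` of the Rademacher functions. -/
def radDiff (x t : Gm m) (s : ℕ) : ℂ := rad m s x * (starRingEnd ℂ) (rad m s t)

theorem charVal_radDiff (x t : Gm m) (n : ℕ) :
    charVal m (radDiff x t) n = vil m n x * (starRingEnd ℂ) (vil m n t) := by
  simp only [charVal, vil, radDiff, mul_pow, Finset.prod_mul_distrib, map_prod, map_pow]

theorem dependsOn_charVal_radDiff (hm : ∀ k, 2 ≤ m k) {n A : ℕ} (h : n < M m A) (x : Gm m) :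
    DependsOn (fun t => charVal m (radDiff x t) n) (Set.Iio A) := fun s t hst => by
  simp only [charVal_eq_prod hm h]
  refine Finset.prod_congr rfl fun k hk => ?_
  simp only [radDiff, rad, hst k (Finset.mem_range.1 hk)]

theorem dependsOn_fejSum_radDiff (hm : ∀ k, 2 ≤ m k) {n A : ℕ} (h : n ≤ M m A) (x : Gm m) :
    DependsOn (fun t => fejSum m (radDiff x t) n) (Set.Iio A) := fun s t hst => by
  refine Finset.sum_congr rfl fun k hk => Finset.sum_congr rfl fun i hi => ?_
  refine dependsOn_charVal_radDiff hm ?_ x hst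
  have := Finset.mem_range.1 hk
  have := Finset.mem_range.1 hi
  omega

theorem exists_M_le_lt (hm : ∀ k, 2 ≤ m k) {n : ℕ} (hn : 0 < n) :
    ∃ J, M m J ≤ n ∧ n < M m (J + 1) := by
  have hex : ∃ J, n < M m J := ⟨n, lt_M hm n⟩
  classical
  obtain ⟨J, hJ⟩ : ∃ J, Nat.find hex = J + 1 := Nat.exists_eq_succ_of_ne_zero fun h0 => by
    have := Nat.find_spec hex
    rw [h0] at this
    simp only [M] at this
    omega
  exact ⟨J, not_lt.1 (Nat.find_min hex (by omega)), hJ ▸ Nat.find_spec hex⟩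

variable [∀ k, NeZero (m k)]

theorem rad_eq_toCircle (k : ℕ) (x : Gm m) : rad m k x = (ZMod.toCircle (x k) : ℂ) := by
  rw [ZMod.toCircle_apply, rad]

theorem radDiff_eq_toCircle (x t : Gm m) (s : ℕ) :
    radDiff x t s = (ZMod.toCircle (x s - t s) : ℂ) := by
  rw [radDiff, rad_eq_toCircle, rad_eq_toCircle, ← Circle.coe_inv_eq_conj, ← Circle.coe_mul,
    ← AddChar.map_neg_eq_inv, ← AddChar.map_add_eq_mul, sub_eq_add_neg]

theorem norm_radDiff (x t : Gm m) (s : ℕ) : ‖radDiff x t s‖ = 1 := by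
  rw [radDiff_eq_toCircle, Circle.norm_coe]

theorem radDiff_pow (x t : Gm m) (s : ℕ) : radDiff x t s ^ m s = 1 := by
  rw [radDiff_eq_toCircle, ← Circle.coe_pow, ← AddChar.map_nsmul_eq_pow]
  simp

theorem radDiff_eq_one {x t : Gm m} {s : ℕ} : radDiff x t s = 1 ↔ x s = t s := by
  rw [radDiff_eq_toCircle, Circle.coe_eq_one, ← AddChar.map_zero_eq_one (ZMod.toCircle (N := m s)),
    ZMod.injective_toCircle.eq_iff, sub_eq_zero]

theorem trivInd_radDiff (x t : Gm m) (i j : ℕ) : trivInd (radDiff x t) i j = agrInd i j x t := by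
  have : (∀ s < j, s ≠ i → radDiff x t s = 1) ↔ t ∈ agree i j x :=
    forall₃_congr fun s _ _ => radDiff_eq_one.trans eq_comm
  unfold trivInd agrInd
  split_ifs <;> simp_all

theorem majorant_radDiff (x t : Gm m) (j : ℕ) : majorant m (radDiff x t) j = kerLevel j x t := by
  simp only [majorant, kerLevel, trivInd_radDiff]

variable {μ : Measure (Gm m)} {lam : ℕ}

theorem IsHaar.norm_setIntegral_mul_fejSum_le (hm : ∀ k, 2 ≤ m k) (hlam : ∀ k, m k ≤ lam)
    (hμ : IsHaar m μ) {h : Gm m → ℂ} {A : ℕ} {u : Gm m} {α : ℝ}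
    (hα : ∀ t ∈ cylAt m A u, ‖h t‖ ≤ α) (hA : A = 0 ∨ ∫ t in cylAt m A u, h t ∂μ = 0)
    {n : ℕ} (hn : 0 < n) (x : Gm m) :
    ‖∫ t in cylAt m A u, h t * fejSum m (radDiff x t) n ∂μ‖ ≤
      n * (3 * (lam : ℝ) ^ 3 * (1 + 4 * lam) * α * (M m A : ℝ)⁻¹ ^ 2 * kerMaj A u x) := by
  have := hμ.isProbabilityMeasure
  have hα0 : 0 ≤ α := (norm_nonneg _).trans (hα u (mem_cylAt_self A u))
  have hG := kerMaj_nonneg A u x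
  rcases lt_or_ge n (M m A) with hnA | hnA
  · have hA0 : A ≠ 0 := by
      rintro rfl
      simp only [M] at hnA
      omega
    have hz := hA.resolve_left hA0
    have : ∫ t in cylAt m A u, h t * fejSum m (radDiff x t) n ∂μ =
        ∫ t in cylAt m A u, h t * fejSum m (radDiff x u) n ∂μ :=
      setIntegral_congr_fun (measurableSet_cylAt A u) fun t ht =>
        congrArg (h t * ·) (dependsOn_fejSum_radDiff hm hnA.le x fun k hk => ht k hk)
    rw [this, integral_mul_const, hz, zero_mul, norm_zero]
    positivity
  · obtain ⟨J, hJ, hJ'⟩ := exists_M_le_lt hm hn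
    have hAJ : A ≤ J := by
      by_contra! hlt
      have := M_mono hm (Nat.succ_le_of_lt hlt)
      simp only [Nat.succ_eq_add_one] at this
      omega
    have hbound : ∀ t ∈ cylAt m A u, ‖h t * fejSum m (radDiff x t) n‖ ≤
        ∑ j ∈ Finset.range (J + 1), ∑ i ∈ Finset.range (j + 1),
          α * (3 * (lam : ℝ) ^ 3) * (M m i * M m j) * agrInd i j x t := by
      intro t ht
      have h1 := norm_fejSum_le hm hlam (norm_radDiff x t) (radDiff_pow x t) hJ'
      rw [norm_mul]
      refine (mul_le_mul (hα t ht) h1 (norm_nonneg _) hα0).trans (le_of_eq ?_)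
      simp only [majorant_radDiff, kerLevel, Finset.mul_sum]
      refine Finset.sum_congr rfl fun j _ => Finset.sum_congr rfl fun i _ => ?_
      ring
    have hint : ∀ i j, Integrable (fun t =>
        α * (3 * (lam : ℝ) ^ 3) * (M m i * M m j) * agrInd i j x t)
        (μ.restrict (cylAt m A u)) := fun i j => (integrable_agrInd i j x).const_mul _
    have e1 : ∫ t in cylAt m A u, ∑ j ∈ Finset.range (J + 1), ∑ i ∈ Finset.range (j + 1),
          α * (3 * (lam : ℝ) ^ 3) * (M m i * M m j) * agrInd i j x t ∂μ =
        α * (3 * (lam : ℝ) ^ 3) * ∑ j ∈ Finset.range (J + 1), ∑ i ∈ Finset.range (j + 1),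
          (M m i : ℝ) * M m j * μ.real (cylAt m A u ∩ agree i j x) := by
      rw [integral_finsetSum _ fun j _ => integrable_finsetSum _ fun i _ => hint i j]
      simp only [Finset.mul_sum]
      refine Finset.sum_congr rfl fun j _ => ?_
      rw [integral_finsetSum _ fun i _ => hint i j]
      refine Finset.sum_congr rfl fun i _ => ?_
      rw [integral_const_mul, setIntegral_agrInd]
      ring
    have h2 := norm_integral_le_of_norm_le (μ := μ.restrict (cylAt m A u))
      (integrable_finsetSum _ fun j _ => integrable_finsetSum _ fun i _ => hint i j)
      ((ae_restrict_iff' (measurableSet_cylAt A u)).2 (ae_of_all _ hbound))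
    refine h2.trans (e1.le.trans ?_)
    have h3 := mul_le_mul_of_nonneg_left (hμ.sum_levels_le hm hlam hAJ u x)
      (by positivity : 0 ≤ α * (3 * (lam : ℝ) ^ 3))
    refine h3.trans ?_
    have hJn : (M m J : ℝ) ≤ n := by exact_mod_cast hJ
    calc _ = (M m J : ℝ) *
          (3 * (lam : ℝ) ^ 3 * (1 + 4 * lam) * α * (M m A : ℝ)⁻¹ ^ 2 * kerMaj A u x) := by ring
      _ ≤ _ := mul_le_mul_of_nonneg_right hJn (by positivity)

end PairKernel

section WeakType

variable {m : ℕ → ℕ}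

theorem sum_half_pow_le (D : ℕ) : ∑ d ∈ Finset.range D, (2⁻¹ : ℝ) ^ d ≤ 2 := by
  have : ∑ d ∈ Finset.range D, (2⁻¹ : ℝ) ^ d = 2 - 2 * 2⁻¹ ^ D := by
    induction D with
    | zero => norm_num
    | succ D ih => rw [Finset.sum_range_succ, ih]; ring
  rw [this]
  have : (0 : ℝ) < 2⁻¹ ^ D := by positivity
  linarith

theorem sum_succ_mul_half_pow_le (D : ℕ) :
    ∑ d ∈ Finset.range D, ((d : ℝ) + 1) * (2⁻¹ : ℝ) ^ d ≤ 4 := by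
  have : ∑ d ∈ Finset.range D, ((d : ℝ) + 1) * (2⁻¹ : ℝ) ^ d = 4 - 2 * (D + 2) * 2⁻¹ ^ D := by
    induction D with
    | zero => norm_num
    | succ D ih => rw [Finset.sum_range_succ, ih]; push_cast; ring
  rw [this]
  have : (0 : ℝ) < 2 * (D + 2) * 2⁻¹ ^ D := by positivity
  linarith

theorem sum_range_le_of_split {a : ℕ → ℝ} (ha : ∀ j, 0 ≤ a j) {r : ℕ} {x y : ℝ}
    (h1 : ∑ j ∈ Finset.range (r + 1), a j ≤ x)
    (h2 : ∀ D, ∑ d ∈ Finset.range D, a (r + 1 + d) ≤ y) (B : ℕ) :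
    ∑ j ∈ Finset.range B, a j ≤ x + y := by
  calc ∑ j ∈ Finset.range B, a j ≤ ∑ j ∈ Finset.range (r + 1 + B), a j :=
        Finset.sum_le_sum_of_subset_of_nonneg (Finset.range_mono (by omega)) fun _ _ _ => ha _
    _ ≤ x + y := by rw [Finset.sum_range_add]; exact add_le_add h1 (h2 B)

theorem sum_good_le (hm : ∀ k, 2 ≤ m k) (r B : ℕ) :
    ∑ j ∈ Finset.range B, ∑ i ∈ Finset.range (j + 1), (if i + j ≤ 2 * r then (M m i : ℝ) else 0) ≤
      6 * M m r := by
  have hr : (0 : ℝ) ≤ M m r := by positivity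
  have key := sum_range_le_of_split (r := r) (x := 4 * M m r) (y := 2 * M m r)
    (a := fun j => ∑ i ∈ Finset.range (j + 1), (if i + j ≤ 2 * r then (M m i : ℝ) else 0))
    (fun j => Finset.sum_nonneg fun i _ => by split_ifs <;> positivity) ?_ ?_ B
  · linarith
  · calc _ ≤ ∑ j ∈ Finset.range (r + 1), 2 * (M m j : ℝ) := by
          refine Finset.sum_le_sum fun j _ => le_trans (Finset.sum_le_sum fun i _ => ?_)
            (sum_M_le hm j)
          split_ifs
          · exact le_rfl
          · positivity
      _ ≤ 4 * M m r := by rw [← Finset.mul_sum]; linarith [sum_M_le hm r]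
  · intro D
    calc _ ≤ ∑ d ∈ Finset.range D, (M m r : ℝ) * 2⁻¹ ^ d := by
          refine Finset.sum_le_sum fun d _ => ?_
          rw [← Finset.sum_filter]
          by_cases hd : d + 1 ≤ r
          · have h1 : (2 : ℝ) ^ (d + 1) * M m (r - (d + 1)) ≤ M m r := by
              have := two_pow_mul_M_le hm (r - (d + 1)) (d + 1)
              rw [Nat.sub_add_cancel hd] at this
              exact_mod_cast this
            calc _ ≤ ∑ i ∈ Finset.range (r - (d + 1) + 1), (M m i : ℝ) := by
                  refine Finset.sum_le_sum_of_subset_of_nonneg (fun i hi => ?_)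
                    fun _ _ _ => by positivity
                  simp only [Finset.mem_filter, Finset.mem_range] at hi ⊢
                  omega
              _ ≤ 2 * M m (r - (d + 1)) := sum_M_le hm _
              _ = (2 : ℝ) ^ (d + 1) * M m (r - (d + 1)) * 2⁻¹ ^ d := by
                  rw [pow_succ, inv_pow]; field_simp
              _ ≤ _ := mul_le_mul_of_nonneg_right h1 (by positivity)
          · rw [Finset.filter_eq_empty_iff.2 fun i _ => by omega, Finset.sum_empty]
            positivity
      _ ≤ 2 * M m r := by
          rw [← Finset.mul_sum]
          nlinarith [sum_half_pow_le D]

theorem sum_bad_le (hm : ∀ k, 2 ≤ m k) (r B : ℕ) :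
    ∑ j ∈ Finset.range B, ∑ i ∈ Finset.range (j + 1),
      (if i + j ≤ 2 * r then 0 else (M m j : ℝ)⁻¹) ≤ 4 * (M m r : ℝ)⁻¹ := by
  have hr : (0 : ℝ) < M m r := by exact_mod_cast M_pos hm r
  have key := sum_range_le_of_split (r := r) (x := 0) (y := 4 * (M m r : ℝ)⁻¹)
    (a := fun j => ∑ i ∈ Finset.range (j + 1), (if i + j ≤ 2 * r then 0 else (M m j : ℝ)⁻¹))
    (fun j => Finset.sum_nonneg fun i _ => by split_ifs <;> positivity) ?_ ?_ B
  · linarith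
  · refine (Finset.sum_eq_zero fun j hj => Finset.sum_eq_zero fun i hi => if_pos ?_).le
    rw [Finset.mem_range] at hi hj
    omega
  · intro D
    calc _ ≤ ∑ d ∈ Finset.range D, (M m r : ℝ)⁻¹ * (((d : ℝ) + 1) * 2⁻¹ ^ d) := by
          refine Finset.sum_le_sum fun d _ => ?_
          have hcard : ((Finset.range (r + 1 + d + 1)).filter
              fun i => ¬ i + (r + 1 + d) ≤ 2 * r).card ≤ 2 * (d + 1) := by
            refine (Finset.card_le_card (t := Finset.Ico (r - d) (r + d + 2)) fun i hi => ?_).trans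
              (by rw [Nat.card_Ico]; omega)
            simp only [Finset.mem_filter, Finset.mem_range, Finset.mem_Ico] at hi ⊢
            omega
          have hM : (2 : ℝ) ^ (d + 1) * M m r ≤ M m (r + 1 + d) := by
            have := two_pow_mul_M_le hm r (d + 1)
            rw [show r + (d + 1) = r + 1 + d by omega] at this
            exact_mod_cast this
          have hinv : (M m (r + 1 + d) : ℝ)⁻¹ ≤ ((2 : ℝ) ^ (d + 1) * M m r)⁻¹ :=
            inv_anti₀ (by positivity) hM
          rw [Finset.sum_ite, Finset.sum_const_zero, zero_add, Finset.sum_const, nsmul_eq_mul]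
          have hc : ((((Finset.range (r + 1 + d + 1)).filter
              fun i => ¬ i + (r + 1 + d) ≤ 2 * r).card : ℕ) : ℝ) ≤ 2 * (d + 1) := by
            exact_mod_cast hcard
          refine (mul_le_mul hc hinv (by positivity) (by positivity)).trans (le_of_eq ?_)
          rw [pow_succ, inv_pow]
          field_simp
      _ ≤ 4 * (M m r : ℝ)⁻¹ := by
          rw [← Finset.mul_sum, mul_comm]
          exact mul_le_mul_of_nonneg_right (sum_succ_mul_half_pow_le D) (by positivity)

variable {μ : Measure (Gm m)} {lam : ℕ} [∀ k, NeZero (m k)]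

/-- At each height `v ^ 2` the function `G` splits into an integrable part and a part with small
support, with the bounds of a function in weak `L_{1/2}`. -/
def SplitsWeakly {X : Type*} [MeasurableSpace X] (μ : Measure X) (C : ℝ) (G : X → ℝ) : Prop :=
  ∀ v : ℝ, 0 < v → ∃ (g : X → ℝ) (E : Set X), (∀ x, 0 ≤ g x) ∧ Integrable g μ ∧
    (∀ x, x ∉ E → G x ≤ g x) ∧ μ.real E ≤ C / v ∧ ∫ x, g x ∂μ ≤ C * v

theorem IsHaar.splitsWeakly_kerMaj (hm : ∀ k, 2 ≤ m k) (hlam : ∀ k, m k ≤ lam)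
    (hμ : IsHaar m μ) (A : ℕ) (u : Gm m) :
    SplitsWeakly μ (6 * (lam : ℝ) ^ 2) (kerMaj A u) := by
  have := hμ.isProbabilityMeasure
  have hl : (1 : ℝ) ≤ lam := by exact_mod_cast (le_trans (by norm_num) (hm 0)).trans (hlam 0)
  intro v hv
  rcases lt_or_ge v 1 with hv1 | hv1
  · refine ⟨0, Set.univ, fun _ => le_rfl, integrable_zero _ _ _, fun x hx => absurd trivial hx,
      ?_, ?_⟩
    · rw [probReal_univ, one_le_div hv]
      nlinarith
    · simp only [Pi.zero_apply, integral_zero]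
      positivity
  · obtain ⟨r, hr, hr'⟩ := exists_M_le_lt hm (Nat.floor_pos.2 hv1)
    have hrv : (M m r : ℝ) ≤ v := le_trans (by exact_mod_cast hr) (Nat.floor_le hv.le)
    have hvr : v ≤ lam * M m r := by
      have h1 : v < M m (r + 1) := (Nat.floor_lt hv.le).1 hr'
      have h2 : (M m (r + 1) : ℝ) ≤ lam * M m r := by
        exact_mod_cast Nat.mul_le_mul_right (M m r) (hlam r)
      linarith
    have hMr : (0 : ℝ) < M m r := by exact_mod_cast M_pos hm r
    have hint : ∀ i j, Integrable (fun x =>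
        (if i + j ≤ 2 * r then (M m i : ℝ) * M m j else 0) * agrInd i j u x) μ :=
      fun i j => (integrable_agrInd i j u).const_mul _
    refine ⟨fun x => ∑ j ∈ Finset.range (A + 1), ∑ i ∈ Finset.range (j + 1),
        (if i + j ≤ 2 * r then (M m i : ℝ) * M m j else 0) * agrInd i j u x,
      ⋃ j ∈ Finset.range (A + 1), ⋃ i ∈ Finset.range (j + 1),
        (if i + j ≤ 2 * r then ∅ else agree i j u), ?_, ?_, ?_, ?_, ?_⟩
    · refine fun x => Finset.sum_nonneg fun j _ => Finset.sum_nonneg fun i _ =>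
        mul_nonneg ?_ (agrInd_nonneg _ _ _ _)
      split_ifs <;> positivity
    · exact integrable_finsetSum _ fun j _ => integrable_finsetSum _ fun i _ => hint i j
    · intro x hx
      simp only [Set.mem_iUnion, not_exists] at hx
      refine (Finset.sum_congr rfl fun j hj => Finset.sum_congr rfl fun i hi => ?_).le
      have := hx j hj i hi
      split_ifs at this ⊢ with hij
      · rfl
      · simp [agrInd, this]
    · calc _ ≤ ∑ j ∈ Finset.range (A + 1), ∑ i ∈ Finset.range (j + 1),
            lam * (if i + j ≤ 2 * r then 0 else (M m j : ℝ)⁻¹) := by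
            refine (measureReal_biUnion_finset_le _ _).trans (Finset.sum_le_sum fun j _ => ?_)
            refine (measureReal_biUnion_finset_le _ _).trans (Finset.sum_le_sum fun i _ => ?_)
            split_ifs
            · simp
            · exact hμ.real_agree_le hlam i j u
        _ ≤ lam * (4 * (M m r : ℝ)⁻¹) := by
            simp only [← Finset.mul_sum]
            exact mul_le_mul_of_nonneg_left (sum_bad_le hm r _) (by positivity)
        _ ≤ _ := by
            rw [← div_eq_mul_inv, ← mul_div_assoc, div_le_div_iff₀ hMr hv]
            nlinarith [mul_le_mul_of_nonneg_left hvr (by positivity : (0 : ℝ) ≤ lam * 4),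
              mul_pos (mul_pos (show (0 : ℝ) < lam by linarith) (show (0 : ℝ) < lam by linarith))
                hMr]
    · rw [integral_finsetSum _ fun j _ => integrable_finsetSum _ fun i _ => hint i j]
      calc _ ≤ ∑ j ∈ Finset.range (A + 1), ∑ i ∈ Finset.range (j + 1),
            lam * (if i + j ≤ 2 * r then (M m i : ℝ) else 0) := by
            refine Finset.sum_le_sum fun j _ => ?_
            rw [integral_finsetSum _ fun i _ => hint i j]
            refine Finset.sum_le_sum fun i _ => ?_
            rw [integral_const_mul, integral_agrInd]
            split_ifs
            · have hj : (0 : ℝ) < M m j := by exact_mod_cast M_pos hm j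
              refine (mul_le_mul_of_nonneg_left (hμ.real_agree_le hlam i j u)
                (by positivity)).trans (le_of_eq ?_)
              field_simp
            · simp
        _ ≤ lam * (6 * M m r) := by
            simp only [← Finset.mul_sum]
            exact mul_le_mul_of_nonneg_left (sum_good_le hm r _) (by positivity)
        _ ≤ _ := by
            have : (lam : ℝ) ≤ (lam : ℝ) ^ 2 := le_self_pow₀ hl (by norm_num)
            nlinarith [mul_le_mul this hrv hMr.le (by positivity)]

theorem measureReal_sum_ge_le {X ι : Type*} [MeasurableSpace X] {μ : Measure X}
    [IsFiniteMeasure μ] {C : ℝ} {G : ι → X → ℝ} (hG : ∀ a, SplitsWeakly μ C (G a))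
    (F : Finset ι) {b : ι → ℝ} (hb : ∀ a, 0 < b a) {τ : ℝ} (hτ : 0 < τ) :
    μ.real {x | τ ^ 2 ≤ ∑ a ∈ F, b a ^ 2 * G a x} ≤ 2 * C / τ * ∑ a ∈ F, b a := by
  choose g E hg0 hgi hGE hE hg using fun a => hG a (τ / b a) (div_pos hτ (hb a))
  have hsub : {x | τ ^ 2 ≤ ∑ a ∈ F, b a ^ 2 * G a x} ⊆
      (⋃ a ∈ F, E a) ∪ {x | τ ^ 2 ≤ ∑ a ∈ F, b a ^ 2 * g a x} := by
    intro x hx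
    by_cases hxE : x ∈ ⋃ a ∈ F, E a
    · exact Or.inl hxE
    · refine Or.inr (le_trans (Set.mem_ofPred.1 hx) (Finset.sum_le_sum fun a ha => ?_))
      simp only [Set.mem_iUnion, not_exists] at hxE
      exact mul_le_mul_of_nonneg_left (hGE a x (hxE a ha)) (by positivity)
  have h1 : μ.real (⋃ a ∈ F, E a) ≤ C / τ * ∑ a ∈ F, b a := by
    refine (measureReal_biUnion_finset_le _ _).trans ?_
    rw [Finset.mul_sum]
    refine Finset.sum_le_sum fun a _ => (hE a).trans (le_of_eq ?_)
    have := hb a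
    field_simp
  have h2 : μ.real {x | τ ^ 2 ≤ ∑ a ∈ F, b a ^ 2 * g a x} ≤ C / τ * ∑ a ∈ F, b a := by
    have h3 := mul_meas_ge_le_integral_of_nonneg (μ := μ)
      (f := fun x => ∑ a ∈ F, b a ^ 2 * g a x)
      (ae_of_all _ fun x => Finset.sum_nonneg fun a _ => mul_nonneg (by positivity) (hg0 a x))
      (integrable_finsetSum _ fun a _ => (hgi a).const_mul _) (τ ^ 2)
    rw [integral_finsetSum _ fun a _ => (hgi a).const_mul _] at h3
    have h4 : ∑ a ∈ F, ∫ x, b a ^ 2 * g a x ∂μ ≤ τ ^ 2 * (C / τ * ∑ a ∈ F, b a) := by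
      rw [Finset.mul_sum, Finset.mul_sum]
      refine Finset.sum_le_sum fun a _ => ?_
      rw [integral_const_mul]
      refine (mul_le_mul_of_nonneg_left (hg a) (by positivity)).trans (le_of_eq ?_)
      have := hb a
      field_simp
    exact le_of_mul_le_mul_left (h3.trans h4) (by positivity)
  refine (measureReal_mono hsub (measure_ne_top _ _)).trans
    ((measureReal_union_le _ _).trans ((add_le_add h1 h2).trans (le_of_eq ?_)))
  ring

end WeakType

theorem norm_sum_monotone_mul_le {q : ℕ → ℝ} (hq : Monotone q) (hq0 : 0 ≤ q 0) {s : ℕ → ℂ} {B : ℝ}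
    {N : ℕ} (hs : ∀ j ≤ N, ‖∑ k ∈ Finset.range j, s k‖ ≤ j * B) :
    ‖∑ k ∈ Finset.range N, (q (N - (k + 1)) : ℂ) * s k‖ ≤ B * ∑ k ∈ Finset.range N, q k := by
  induction N generalizing q with
  | zero => simp
  | succ N ih =>
    have ih' := ih (q := fun i => q (i + 1) - q 0)
      (fun i j hij => sub_le_sub_right (hq (Nat.succ_le_succ hij)) _)
      (sub_nonneg.2 (hq (Nat.zero_le _))) fun j hj => hs j (hj.trans N.le_succ)
    have e : ∑ k ∈ Finset.range (N + 1), (q (N + 1 - (k + 1)) : ℂ) * s k =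
        (q 0 : ℂ) * ∑ k ∈ Finset.range (N + 1), s k +
        ∑ k ∈ Finset.range N, ((q (N - (k + 1) + 1) - q 0 : ℝ) : ℂ) * s k := by
      rw [Finset.sum_range_succ, Finset.sum_range_succ, mul_add, Finset.mul_sum, Nat.sub_self,
        add_right_comm, ← Finset.sum_add_distrib]
      congr 1
      refine Finset.sum_congr rfl fun k hk => ?_
      have := Finset.mem_range.1 hk
      rw [show N + 1 - (k + 1) = N - (k + 1) + 1 by omega]
      push_cast
      ring
    rw [e, Finset.sum_range_succ' q]
    refine (norm_add_le _ _).trans ?_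
    rw [norm_mul, Complex.norm_real, Real.norm_of_nonneg hq0]
    have h1 := mul_le_mul_of_nonneg_left (hs (N + 1) le_rfl) hq0
    have h2 : B * ∑ k ∈ Finset.range N, (q (k + 1) - q 0) =
        B * ∑ k ∈ Finset.range N, q (k + 1) - B * (N * q 0) := by
      rw [Finset.sum_sub_distrib, Finset.sum_const, Finset.card_range, nsmul_eq_mul, mul_sub]
    push_cast at h1
    linarith

section Martingale

variable {m : ℕ → ℕ} {μ : Measure (Gm m)} {f : ℕ → Gm m → ℂ}

theorem dependsOn_vil (i : ℕ) : DependsOn (vil m i) (Set.Iio (i + 1)) := fun x y h =>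
  Finset.prod_congr rfl fun k hk => by simp only [rad, h k (Finset.mem_range.1 hk)]

theorem IsMartingale.dependsOn (hf : IsMartingale m μ f) {n N : ℕ} (h : n ≤ N) :
    DependsOn (f n) (Set.Iio N) :=
  fun x y hxy => hf.adapted n x y fun k hk => hxy k (lt_of_lt_of_le hk h)

theorem IsMartingale.setIntegral_cylAt (hm : ∀ k, 2 ≤ m k) (hf : IsMartingale m μ f)
    {n N : ℕ} (h : n ≤ N) (x : Gm m) :
    ∫ t in cylAt m n x, f N t ∂μ = (M m n : ℂ)⁻¹ * f n x := by
  rw [hf.mart n N h x, inv_mul_cancel_left₀]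
  exact_mod_cast (M_pos hm n).ne'

variable [∀ k, NeZero (m k)]

theorem IsMartingale.integral_mul_eq (hm : ∀ k, 2 ≤ m k) (hμ : IsHaar m μ)
    (hf : IsMartingale m μ f) {φ : Gm m → ℂ} {N N' : ℕ} (hφ : DependsOn φ (Set.Iio N))
    (h : N ≤ N') : ∫ t, f N' t * φ t ∂μ = ∫ t, f N t * φ t ∂μ := by
  have := hμ.isProbabilityMeasure
  have key : ∀ j, N ≤ j → ∫ t, f j t * φ t ∂μ =
      ∑ u ∈ reps m N, (M m N : ℂ)⁻¹ * f N u * φ u := fun j hj => by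
    have hint : Integrable (fun t => f j t * φ t) μ :=
      integrable_of_dependsOn (A := j) fun x y hxy => by
        simp only [hf.dependsOn le_rfl hxy, hφ fun k hk => hxy k (lt_of_lt_of_le hk hj)]
    rw [integral_eq_sum_reps N hint]
    refine Finset.sum_congr rfl fun u _ => ?_
    rw [← hf.setIntegral_cylAt hm hj, ← integral_mul_const]
    exact setIntegral_congr_fun (measurableSet_cylAt N u) fun t ht =>
      congrArg (f j t * ·) (hφ ht)
  rw [key N' h, key N le_rfl]

theorem IsMartingale.sum_S_eq (hm : ∀ k, 2 ≤ m k) (hμ : IsHaar m μ) (hf : IsMartingale m μ f)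
    {n L : ℕ} (h : n ≤ L) (x : Gm m) :
    ∑ k ∈ Finset.range n, S m μ f (k + 1) x = ∫ t, f L t * fejSum m (radDiff x t) n ∂μ := by
  have := hμ.isProbabilityMeasure
  have hint : ∀ i < L, Integrable (fun t => f L t * charVal m (radDiff x t) i) μ := fun i hi =>
    integrable_of_dependsOn (A := L) fun s t hst => by
      have := dependsOn_charVal_radDiff hm (hi.trans (lt_M hm L)) x hst
      simp only at this
      simp only [hf.dependsOn le_rfl hst, this]
  have hcoeff : ∀ i < L, coeff m μ f i * vil m i x =
      ∫ t, f L t * charVal m (radDiff x t) i ∂μ := fun i hi => by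
    have h1 := hf.integral_mul_eq hm hμ (φ := fun t => (starRingEnd ℂ) (vil m i t))
      (fun s t hst => congrArg _ (dependsOn_vil i hst)) (Nat.succ_le_of_lt hi)
    rw [coeff, ← h1, ← integral_mul_const]
    refine integral_congr_ae (ae_of_all _ fun t => ?_)
    simp only [charVal_radDiff]
    ring
  have hlt : ∀ k ∈ Finset.range n, ∀ i ∈ Finset.range (k + 1), i < L := fun k hk i hi => by
    rw [Finset.mem_range] at hk hi
    omega
  simp only [fejSum, dirSum, Finset.mul_sum, S]
  rw [integral_finsetSum _ fun k hk => integrable_finsetSum _ fun i hi => hint i (hlt k hk i hi)]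
  refine Finset.sum_congr rfl fun k hk => ?_
  rw [integral_finsetSum _ fun i hi => hint i (hlt k hk i hi)]
  exact Finset.sum_congr rfl fun i hi => hcoeff i (hlt k hk i hi)

end Martingale

section Stopping

variable {m : ℕ → ℕ}

/-- `τ` is a stopping time for the filtration generated by the coordinates. -/
def IsStopping (τ : Gm m → ℕ) : Prop := ∀ x, ∀ y ∈ cylAt m (τ x) x, τ y = τ x

theorem IsStopping.dependsOn_eq {τ : Gm m → ℕ} (hτ : IsStopping τ) (N : ℕ) :
    DependsOn (fun x => τ x = N) (Set.Iio N) := fun x y h => by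
  refine propext ⟨fun hx => ?_, fun hy => ?_⟩
  · exact (hτ x y fun k hk => (h k (hx ▸ hk)).symm).trans hx
  · exact (hτ y x fun k hk => h k (hy ▸ hk)).trans hy

theorem IsStopping.dependsOn_apply {τ : Gm m → ℕ} (hτ : IsStopping τ) {μ : Measure (Gm m)}
    {f : ℕ → Gm m → ℂ} (hf : IsMartingale m μ f) {L : ℕ} (hL : ∀ x, τ x ≤ L) :
    DependsOn (fun x => f (τ x) x) (Set.Iio L) := fun x y h => by
  have : τ y = τ x := hτ x y fun k hk => (h k (lt_of_lt_of_le hk (hL x))).symm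
  simp only [this]
  exact hf.dependsOn (hL x) h

/-- The pairs `(A, u)` describing the maximal cylinders on which `τ = A < L`. -/
def atoms [∀ k, NeZero (m k)] (τ : Gm m → ℕ) (L : ℕ) : Finset (Σ _ : ℕ, Gm m) :=
  ((Finset.range L).sigma fun A => reps m A).filter fun a => τ a.2 = a.1

variable [∀ k, NeZero (m k)] {τ : Gm m → ℕ} {L : ℕ}

theorem mem_atoms {a : Σ _ : ℕ, Gm m} :
    a ∈ atoms τ L ↔ (a.1 < L ∧ a.2 ∈ reps m a.1) ∧ τ a.2 = a.1 := by
  simp [atoms]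

theorem IsStopping.eq_of_mem_atoms (hτ : IsStopping τ) {a : Σ _ : ℕ, Gm m} (ha : a ∈ atoms τ L)
    {x : Gm m} (hx : x ∈ cylAt m a.1 a.2) : τ x = a.1 := by
  have h := (mem_atoms.1 ha).2
  rw [hτ a.2 x (h.symm ▸ hx), h]

theorem IsStopping.pairwiseDisjoint_atoms (hτ : IsStopping τ) :
    (↑(atoms τ L) : Set (Σ _ : ℕ, Gm m)).PairwiseDisjoint fun a => cylAt m a.1 a.2 := by
  intro a ha b hb hab
  refine Set.disjoint_left.2 fun x hx hx' => hab ?_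
  have h1 := hτ.eq_of_mem_atoms ha hx
  have h2 := hτ.eq_of_mem_atoms hb hx'
  have h3 := eq_trunc_of_mem_reps (mem_atoms.1 ha).1.2 hx
  have h4 := eq_trunc_of_mem_reps (mem_atoms.1 hb).1.2 hx'
  obtain ⟨A, u⟩ := a
  obtain ⟨B, v⟩ := b
  simp only at h1 h2 h3 h4
  obtain rfl := h1.symm.trans h2
  rw [h3, h4]

theorem IsStopping.biUnion_atoms (hτ : IsStopping τ) :
    ⋃ a ∈ atoms τ L, cylAt m a.1 a.2 = {x | τ x < L} := by
  ext x
  simp only [Set.mem_iUnion, exists_prop, Set.mem_ofPred]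
  constructor
  · rintro ⟨a, ha, hx⟩
    exact (hτ.eq_of_mem_atoms ha hx).trans_lt (mem_atoms.1 ha).1.1
  · intro hx
    refine ⟨⟨τ x, trunc (τ x) x⟩, mem_atoms.2 ⟨⟨hx, trunc_mem_reps _ _⟩, ?_⟩,
      mem_cylAt_trunc _ _⟩
    exact hτ x _ fun k hk => trunc_of_lt x hk

variable {μ : Measure (Gm m)} {f : ℕ → Gm m → ℂ}

theorem IsStopping.setIntegral_eq (hm : ∀ k, 2 ≤ m k) (hμ : IsHaar m μ)
    (hf : IsMartingale m μ f) (hτ : IsStopping τ) (hL : ∀ x, τ x ≤ L) {A : ℕ} {u : Gm m}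
    (hA : ∀ x ∈ cylAt m A u, A ≤ τ x) :
    ∫ x in cylAt m A u, f (τ x) x ∂μ = ∫ x in cylAt m A u, f L x ∂μ := by
  classical
  have := hμ.isProbabilityMeasure
  let φ : ℕ → Gm m → ℂ := fun N x => if x ∈ cylAt m A u ∧ τ x = N then 1 else 0
  have hφ : ∀ N, DependsOn (φ N) (Set.Iio N) := fun N x y h => by
    rcases lt_or_ge N A with hN | hN
    · have : ∀ z, φ N z = 0 := fun z => if_neg fun hz => by
        have := hA z hz.1
        omega
      rw [this, this]
    · have h1 : (x ∈ cylAt m A u) = (y ∈ cylAt m A u) :=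
        propext ⟨fun H k hk => (h k (hk.trans_le hN)).symm.trans (H k hk),
          fun H k hk => (h k (hk.trans_le hN)).trans (H k hk)⟩
      have h2 := hτ.dependsOn_eq N h
      simp only at h2
      simp only [φ, h1, h2]
  have hφint : ∀ N ≤ L, ∀ j ≤ L, Integrable (fun x => f j x * φ N x) μ := fun N hN j hj =>
    integrable_of_dependsOn (A := L) fun x y h => by
      simp only [hf.dependsOn hj h, hφ N fun k hk => h k (lt_of_lt_of_le hk hN)]
  have e1 : ∀ x, (cylAt m A u).indicator (fun x => f (τ x) x) x =
      ∑ N ∈ Finset.range (L + 1), f N x * φ N x := fun x => by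
    by_cases hx : x ∈ cylAt m A u
    · simp [φ, hx, Nat.lt_succ_of_le (hL x)]
    · simp [φ, hx]
  have e2 : ∀ x, (cylAt m A u).indicator (fun x => f L x) x =
      ∑ N ∈ Finset.range (L + 1), f L x * φ N x := fun x => by
    by_cases hx : x ∈ cylAt m A u
    · simp [φ, hx, Nat.lt_succ_of_le (hL x)]
    · simp [φ, hx]
  have hmem : ∀ N ∈ Finset.range (L + 1), N ≤ L := fun N hN =>
    Nat.le_of_lt_succ (Finset.mem_range.1 hN)
  rw [← integral_indicator (measurableSet_cylAt A u),
    ← integral_indicator (measurableSet_cylAt A u)]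
  simp only [e1, e2]
  rw [integral_finsetSum _ fun N hN => hφint N (hmem N hN) N (hmem N hN),
    integral_finsetSum _ fun N hN => hφint N (hmem N hN) L le_rfl]
  exact Finset.sum_congr rfl fun N hN => (hf.integral_mul_eq hm hμ (hφ N) (hmem N hN)).symm

end Stopping

section PassTime

variable {m : ℕ → ℕ} {f : ℕ → Gm m → ℂ} {L : ℕ} {s : ℝ}

/-- The last time before `L` up to which the martingale is surely bounded by `s`. -/
def passTime (f : ℕ → Gm m → ℂ) (L : ℕ) (s : ℝ) (x : Gm m) : ℕ :=
  sInf {N | L ≤ N ∨ ∃ y ∈ cylAt m N x, s < ‖f (N + 1) y‖}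

theorem passTime_spec (x : Gm m) :
    L ≤ passTime f L s x ∨ ∃ y ∈ cylAt m (passTime f L s x) x, s < ‖f (passTime f L s x + 1) y‖ :=
  Nat.sInf_mem (s := {N | L ≤ N ∨ ∃ y ∈ cylAt m N x, s < ‖f (N + 1) y‖}) ⟨L, Or.inl le_rfl⟩

theorem passTime_le (x : Gm m) : passTime f L s x ≤ L := Nat.sInf_le (Or.inl le_rfl)

theorem passTime_le_of_mem {N : ℕ} {x y : Gm m} (hy : y ∈ cylAt m N x) (h : s < ‖f (N + 1) y‖) :
    passTime f L s x ≤ N := Nat.sInf_le (Or.inr ⟨y, hy, h⟩)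

theorem norm_le_of_lt_passTime {N : ℕ} {x : Gm m} (h : N < passTime f L s x) :
    ‖f (N + 1) x‖ ≤ s := by
  by_contra! hlt
  exact (passTime_le_of_mem (mem_cylAt_self N x) hlt).not_gt h

theorem isStopping_passTime : IsStopping (passTime f L s) := by
  intro x y hy
  have key : ∀ x y, y ∈ cylAt m (passTime f L s x) x → passTime f L s y ≤ passTime f L s x := by
    intro x y hy
    rcases passTime_spec (f := f) (L := L) (s := s) x with h | ⟨z, hz, h⟩
    · exact (passTime_le y).trans h
    · exact passTime_le_of_mem (cylAt_eq_of_mem hy ▸ hz) h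
  have h1 := key x y hy
  refine le_antisymm h1 (key y x ?_)
  exact fun k hk => (hy k (hk.trans_le h1)).symm

theorem norm_apply_passTime_le (h0 : ∀ x, ‖f 0 x‖ ≤ s) (x : Gm m) :
    ‖f (passTime f L s x) x‖ ≤ s := by
  rcases h : passTime f L s x with _ | N
  · exact h0 x
  · exact norm_le_of_lt_passTime (L := L) (h ▸ N.lt_succ_self)

theorem passTime_mono {s' : ℝ} (h : s ≤ s') (x : Gm m) : passTime f L s x ≤ passTime f L s' x := by
  rcases passTime_spec (f := f) (L := L) (s := s') x with h' | ⟨y, hy, h'⟩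
  · exact (passTime_le x).trans h'
  · exact passTime_le_of_mem hy (h.trans_lt h')

theorem passTime_eq_of_bound (h : ∀ j ≤ L, ∀ x, ‖f j x‖ ≤ s) (x : Gm m) :
    passTime f L s x = L := by
  refine (passTime_le x).antisymm ?_
  rcases passTime_spec (f := f) (L := L) (s := s) x with h' | ⟨y, -, h'⟩
  · exact h'
  · by_contra! hlt
    exact (h _ (Nat.succ_le_of_lt hlt) y).not_gt h'

variable [∀ k, NeZero (m k)] {μ : Measure (Gm m)} {lam : ℕ}

theorem measurableSet_exists_lt_norm (hf : IsMartingale m μ f) (s : ℝ) :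
    MeasurableSet {x | ∃ j ≤ L, s < ‖f j x‖} :=
  measurableSet_of_dependsOn (A := L) fun x y h => by
    simp only [Set.mem_ofPred, eq_iff_iff]
    refine exists_congr fun j => and_congr_right fun hj => ?_
    rw [hf.dependsOn hj h]

theorem IsHaar.sum_atoms_passTime_le (hm : ∀ k, 2 ≤ m k) (hlam : ∀ k, m k ≤ lam)
    (hμ : IsHaar m μ) (hf : IsMartingale m μ f) :
    ∑ a ∈ atoms (passTime f L s) L, (M m a.1 : ℝ)⁻¹ ≤
      lam * μ.real {x | ∃ j ≤ L, s < ‖f j x‖} := by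
  have := hμ.isProbabilityMeasure
  have hV : MeasurableSet {x | ∃ j ≤ L, s < ‖f j x‖} := measurableSet_exists_lt_norm hf s
  calc _ ≤ ∑ a ∈ atoms (passTime f L s) L,
        lam * μ.real (cylAt m a.1 a.2 ∩ {x | ∃ j ≤ L, s < ‖f j x‖}) := by
        refine Finset.sum_le_sum fun a ha => ?_
        have ha' := mem_atoms.1 ha
        have hspec := passTime_spec (f := f) (L := L) (s := s) a.2
        rw [ha'.2] at hspec
        obtain ⟨y, hy, hsy⟩ := hspec.resolve_left (by have := ha'.1.1; omega)
        have hsub : cylAt m (a.1 + 1) y ⊆ cylAt m a.1 a.2 ∩ {x | ∃ j ≤ L, s < ‖f j x‖} := by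
          refine fun x hx => ⟨cylAt_eq_of_mem hy ▸ cylAt_anti a.1.le_succ y hx,
            a.1 + 1, ha'.1.1, ?_⟩
          rwa [hf.adapted (a.1 + 1) x y hx]
        have h1 := measureReal_mono hsub (measure_ne_top μ _)
        rw [hμ.real_cylAt] at h1
        have hA : (0 : ℝ) < M m a.1 := by exact_mod_cast M_pos hm a.1
        have hA' : (0 : ℝ) < M m (a.1 + 1) := by exact_mod_cast M_pos hm (a.1 + 1)
        have h2 : (M m (a.1 + 1) : ℝ) ≤ lam * M m a.1 := by
          exact_mod_cast Nat.mul_le_mul_right (M m a.1) (hlam a.1)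
        refine le_trans ?_ (mul_le_mul_of_nonneg_left h1 (Nat.cast_nonneg lam))
        rw [← div_eq_mul_inv, inv_eq_one_div, div_le_div_iff₀ hA hA']
        linarith
    _ = lam * μ.real (⋃ a ∈ atoms (passTime f L s) L,
          cylAt m a.1 a.2 ∩ {x | ∃ j ≤ L, s < ‖f j x‖}) := by
        rw [← Finset.mul_sum, measureReal_biUnion_finset]
        · exact fun a ha b hb hab => (isStopping_passTime.pairwiseDisjoint_atoms ha hb hab).mono
            Set.inter_subset_left Set.inter_subset_left
        · exact fun a _ => (measurableSet_cylAt _ _).inter hV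
    _ ≤ _ := mul_le_mul_of_nonneg_left (measureReal_mono
        (Set.iUnion₂_subset fun a _ => Set.inter_subset_right) (measure_ne_top _ _))
        (Nat.cast_nonneg lam)

end PassTime

section Decomposition

variable {m : ℕ → ℕ} [∀ k, NeZero (m k)] {μ : Measure (Gm m)} {f : ℕ → Gm m → ℂ} {lam L : ℕ}

theorem IsStopping.integrable_mul_fejSum (hm : ∀ k, 2 ≤ m k) (hμ : IsHaar m μ)
    (hf : IsMartingale m μ f) {τ : Gm m → ℕ} (hτ : IsStopping τ) (hL : ∀ x, τ x ≤ L)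
    {n : ℕ} (hn : n ≤ L) (x : Gm m) :
    Integrable (fun t => f (τ t) t * fejSum m (radDiff x t) n) μ := by
  have := hμ.isProbabilityMeasure
  refine integrable_of_dependsOn (A := L) fun s t hst => ?_
  have h1 := hτ.dependsOn_apply hf hL hst
  have h2 := dependsOn_fejSum_radDiff hm (hn.trans (lt_M hm L).le) x hst
  simp only at h1 h2
  simp only [h1, h2]

theorem IsHaar.norm_integral_sub_le (hm : ∀ k, 2 ≤ m k) (hlam : ∀ k, m k ≤ lam)
    (hμ : IsHaar m μ) (hf : IsMartingale m μ f) {σ τ : Gm m → ℕ} (hσ : IsStopping σ)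
    (hτ : IsStopping τ) (hστ : ∀ x, σ x ≤ τ x) (hL : ∀ x, τ x ≤ L) {α : ℝ}
    (hα : ∀ x, ‖f (τ x) x - f (σ x) x‖ ≤ α) {n : ℕ} (hn : 0 < n) (hnL : n ≤ L) (x : Gm m) :
    ‖∫ t, (f (τ t) t - f (σ t) t) * fejSum m (radDiff x t) n ∂μ‖ ≤
      n * ∑ a ∈ atoms σ L,
        3 * (lam : ℝ) ^ 3 * (1 + 4 * lam) * α * (M m a.1 : ℝ)⁻¹ ^ 2 * kerMaj a.1 a.2 x := by
  have := hμ.isProbabilityMeasure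
  have hLσ := fun x => (hστ x).trans (hL x)
  have hint : Integrable (fun t => (f (τ t) t - f (σ t) t) * fejSum m (radDiff x t) n) μ := by
    simp only [sub_mul]
    exact (hτ.integrable_mul_fejSum hm hμ hf hL hnL x).sub
      (hσ.integrable_mul_fejSum hm hμ hf hLσ hnL x)
  have hzero : ∀ t, t ∉ ⋃ a ∈ atoms σ L, cylAt m a.1 a.2 →
      (f (τ t) t - f (σ t) t) * fejSum m (radDiff x t) n = 0 := fun t ht => by
    rw [hσ.biUnion_atoms, Set.mem_ofPred, not_lt] at ht
    rw [le_antisymm (hστ t) ((hL t).trans ht), sub_self, zero_mul]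
  rw [← setIntegral_eq_integral_of_forall_compl_eq_zero hzero,
    integral_biUnion_finset _ (fun a _ => measurableSet_cylAt _ _) hσ.pairwiseDisjoint_atoms
      fun a _ => hint.integrableOn, Finset.mul_sum]
  refine (norm_sum_le _ _).trans (Finset.sum_le_sum fun a ha => ?_)
  refine hμ.norm_setIntegral_mul_fejSum_le hm hlam (fun t _ => hα t) (Or.inr ?_) hn x
  have hA : ∀ t ∈ cylAt m a.1 a.2, a.1 ≤ σ t := fun t ht => (hσ.eq_of_mem_atoms ha ht).ge
  rw [integral_sub (integrable_of_dependsOn (hτ.dependsOn_apply hf hL)).integrableOn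
      (integrable_of_dependsOn (hσ.dependsOn_apply hf hLσ)).integrableOn,
    hτ.setIntegral_eq hm hμ hf hL fun t ht => (hA t ht).trans (hστ t),
    hσ.setIntegral_eq hm hμ hf hLσ hA, sub_self]

theorem IsHaar.norm_sum_S_le (hm : ∀ k, 2 ≤ m k) (hlam : ∀ k, m k ≤ lam)
    (hμ : IsHaar m μ) (hf : IsMartingale m μ f) {ε : ℝ} (h0 : ∀ x, ‖f 0 x‖ ≤ ε) {K : ℕ}
    (hK : ∀ j ≤ L, ∀ x, ‖f j x‖ ≤ ε * 4 ^ K) {n : ℕ} (hnL : n ≤ L) (x : Gm m) :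
    ‖∑ k ∈ Finset.range n, S m μ f (k + 1) x‖ ≤
      n * (3 * (lam : ℝ) ^ 3 * (1 + 4 * lam) * ε * kerMaj 0 0 x +
        ∑ k ∈ Finset.range K, ∑ a ∈ atoms (passTime f L (ε * 4 ^ k)) L,
          3 * (lam : ℝ) ^ 3 * (1 + 4 * lam) * (5 * ε * 4 ^ k) * (M m a.1 : ℝ)⁻¹ ^ 2 *
            kerMaj a.1 a.2 x) := by
  rcases n.eq_zero_or_pos with rfl | hn
  · simp
  have := hμ.isProbabilityMeasure
  have hε : 0 ≤ ε := (norm_nonneg _).trans (h0 0)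
  let ν : ℕ → Gm m → ℕ := fun k => passTime f L (ε * 4 ^ k)
  have hbound : ∀ k t, ‖f (ν k t) t‖ ≤ ε * 4 ^ k := fun k t =>
    norm_apply_passTime_le (fun t => (h0 t).trans
      (le_mul_of_one_le_right hε (one_le_pow₀ (by norm_num)))) t
  have hint : ∀ k, Integrable (fun t => f (ν k t) t * fejSum m (radDiff x t) n) μ := fun k =>
    isStopping_passTime.integrable_mul_fejSum hm hμ hf (fun t => passTime_le t) hnL x
  have hint' : ∀ k, Integrable
      (fun t => (f (ν (k + 1) t) t - f (ν k t) t) * fejSum m (radDiff x t) n) μ := fun k => by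
    simp only [sub_mul]
    exact (hint _).sub (hint _)
  have hdec : ∀ t, f L t * fejSum m (radDiff x t) n = f (ν 0 t) t * fejSum m (radDiff x t) n +
      ∑ k ∈ Finset.range K,
        (f (ν (k + 1) t) t - f (ν k t) t) * fejSum m (radDiff x t) n := fun t => by
    rw [← Finset.sum_mul, Finset.sum_range_sub (fun k => f (ν k t) t), ← add_mul,
      add_sub_cancel, show ν K t = L from passTime_eq_of_bound hK t]
  rw [hf.sum_S_eq hm hμ hnL]
  simp only [hdec]
  rw [integral_add (hint 0) (integrable_finsetSum _ fun k _ => hint' k),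
    integral_finsetSum _ fun k _ => hint' k, mul_add, Finset.mul_sum]
  refine (norm_add_le _ _).trans (add_le_add ?_ ((norm_sum_le _ _).trans
    (Finset.sum_le_sum fun k _ => ?_)))
  · have h1 := hμ.norm_setIntegral_mul_fejSum_le hm hlam (A := 0) (u := 0)
      (fun t _ => (hbound 0 t).trans (by simp)) (Or.inl rfl) hn x (α := ε)
    simpa [cylAt_zero, M] using h1
  · refine hμ.norm_integral_sub_le hm hlam hf isStopping_passTime isStopping_passTime
      (fun t => passTime_mono ?_ t) (fun t => passTime_le t) (fun t => ?_) hn hnL x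
    · exact mul_le_mul_of_nonneg_left (pow_le_pow_right₀ (by norm_num) k.le_succ) hε
    · refine (norm_sub_le _ _).trans ((add_le_add (hbound (k + 1) t) (hbound k t)).trans
        (le_of_eq ?_))
      ring

end Decomposition

section WeakBound

variable {m : ℕ → ℕ} {μ : Measure (Gm m)} {f : ℕ → Gm m → ℂ} {lam L : ℕ}

theorem norm_T_le {q : ℕ → ℝ} (hq : Monotone q) (hq0 : 0 < q 0) {x : Gm m} {B : ℝ} (hB : 0 ≤ B)
    {n : ℕ} (h : ∀ j ≤ n, ‖∑ k ∈ Finset.range j, S m μ f (k + 1) x‖ ≤ j * B) :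
    ‖T m μ q f n x‖ ≤ B := by
  have hQ : 0 ≤ ∑ k ∈ Finset.range n, q k :=
    Finset.sum_nonneg fun k _ => hq0.le.trans (hq (Nat.zero_le k))
  rw [T, norm_mul, norm_inv, Complex.norm_real, Real.norm_of_nonneg hQ]
  refine (mul_le_mul_of_nonneg_left (norm_sum_monotone_mul_le hq hq0.le h)
    (inv_nonneg.2 hQ)).trans ?_
  rw [mul_left_comm]
  exact mul_le_of_le_one_right hB inv_mul_le_one

theorem sum_dyadic_le {c v : ℝ} (hc : 0 ≤ c) (hv : 0 ≤ v) {p : ℕ → Prop} [DecidablePred p]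
    (hp : ∀ k, p k → c * 2 ^ k ≤ v) (K : ℕ) :
    ∑ k ∈ Finset.range K, (if p k then c * 2 ^ k else 0) ≤ 2 * v := by
  have hgeom : ∀ K, ∑ k ∈ Finset.range K, (if p k then c * 2 ^ k else 0) ≤ c * 2 ^ K := by
    intro K
    induction K with
    | zero => simpa using hc
    | succ K ih =>
      rw [Finset.sum_range_succ, pow_succ]
      have : 0 ≤ c * 2 ^ K := by positivity
      split_ifs <;> linarith
  induction K with
  | zero => simpa using hv
  | succ K ih =>
    rw [Finset.sum_range_succ]
    split_ifs with h
    · linarith [hgeom K, hp K h]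
    · linarith

theorem nnnorm_le_mstar (n : ℕ) (x : Gm m) : (‖f n x‖₊ : ℝ≥0∞) ≤ mstar m f x :=
  le_iSup (fun n => (‖f n x‖₊ : ℝ≥0∞)) n

theorem le_toReal_mstar_rpow {c : ℝ} (hc : 0 ≤ c) {n : ℕ} {x : Gm m} (h : c ^ 2 ≤ ‖f n x‖)
    (hx : mstar m f x ^ (1 / 2 : ℝ) ≠ ⊤) : c ≤ (mstar m f x ^ (1 / 2 : ℝ)).toReal := by
  rw [← ENNReal.ofReal_le_iff_le_toReal hx]
  calc ENNReal.ofReal c = ENNReal.ofReal (c ^ 2) ^ (1 / 2 : ℝ) := by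
        rw [ENNReal.ofReal_rpow_of_nonneg (by positivity) (by norm_num), ← Real.sqrt_eq_rpow,
          Real.sqrt_sq hc]
    _ ≤ _ := by
        refine ENNReal.rpow_le_rpow ?_ (by norm_num)
        exact (ENNReal.ofReal_le_coe.2 h).trans (nnnorm_le_mstar n x)

theorem IsHaar.norm_zero_le (hμ : IsHaar m μ) (hf : IsMartingale m μ f)
    (hfin : ∫⁻ x, mstar m f x ^ (1 / 2 : ℝ) ∂μ ≠ ⊤) (x : Gm m) :
    ‖f 0 x‖ ≤ (∫⁻ x, mstar m f x ^ (1 / 2 : ℝ) ∂μ).toReal ^ 2 := by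
  have := hμ.isProbabilityMeasure
  have h1 : (‖f 0 x‖₊ : ℝ≥0∞) ^ (1 / 2 : ℝ) ≤ ∫⁻ x, mstar m f x ^ (1 / 2 : ℝ) ∂μ := by
    calc (‖f 0 x‖₊ : ℝ≥0∞) ^ (1 / 2 : ℝ) = ∫⁻ _, (‖f 0 x‖₊ : ℝ≥0∞) ^ (1 / 2 : ℝ) ∂μ := by simp
      _ ≤ _ := lintegral_mono fun y => ENNReal.rpow_le_rpow
          (by rw [hf.adapted 0 x y (by simp)]; exact nnnorm_le_mstar 0 y) (by norm_num)
  have h2 := ENNReal.toReal_mono hfin h1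
  rw [← ENNReal.toReal_rpow, ENNReal.coe_toReal, coe_nnnorm, ← Real.sqrt_eq_rpow] at h2
  calc ‖f 0 x‖ = √‖f 0 x‖ ^ 2 := (Real.sq_sqrt (norm_nonneg _)).symm
    _ ≤ _ := pow_le_pow_left₀ (Real.sqrt_nonneg _) h2 2

variable [∀ k, NeZero (m k)]

theorem IsHaar.sum_dyadic_measureReal_le (hμ : IsHaar m μ) (hf : IsMartingale m μ f)
    (hfin : ∫⁻ x, mstar m f x ^ (1 / 2 : ℝ) ∂μ ≠ ⊤) {η : ℝ} (hη : 0 ≤ η) (K : ℕ) :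
    ∑ k ∈ Finset.range K, η * 2 ^ k * μ.real {x | ∃ j ≤ L, η ^ 2 * 4 ^ k < ‖f j x‖} ≤
      2 * (∫⁻ x, mstar m f x ^ (1 / 2 : ℝ) ∂μ).toReal := by
  classical
  have := hμ.isProbabilityMeasure
  let V : ℕ → Set (Gm m) := fun k => {x | ∃ j ≤ L, η ^ 2 * 4 ^ k < ‖f j x‖}
  have hV : ∀ k, MeasurableSet (V k) := fun k => measurableSet_exists_lt_norm hf _
  have hpt : ∀ x, ∑ k ∈ Finset.range K, (V k).indicator (fun _ => ENNReal.ofReal (η * 2 ^ k)) x ≤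
      2 * mstar m f x ^ (1 / 2 : ℝ) := by
    intro x
    by_cases hx : mstar m f x ^ (1 / 2 : ℝ) = ⊤
    · rw [hx, ENNReal.mul_top (by norm_num)]
      exact le_top
    · have h1 := sum_dyadic_le hη (v := (mstar m f x ^ (1 / 2 : ℝ)).toReal) ENNReal.toReal_nonneg
        (p := fun k => x ∈ V k) (fun k ⟨j, _, hj⟩ => le_toReal_mstar_rpow (by positivity) (n := j)
          (by
            refine le_trans (le_of_eq ?_) hj.le
            rw [mul_pow, ← pow_mul, mul_comm k, pow_mul]
            norm_num) hx) K
      have h2 := ENNReal.ofReal_le_ofReal h1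
      rw [ENNReal.ofReal_mul (by norm_num), ENNReal.ofReal_toReal hx, ENNReal.ofReal_ofNat,
        ENNReal.ofReal_sum_of_nonneg fun k _ => by split_ifs <;> positivity] at h2
      refine le_trans (le_of_eq ?_) h2
      refine Finset.sum_congr rfl fun k _ => ?_
      by_cases hk : x ∈ V k <;> simp [hk]
  have h1 := lintegral_mono (μ := μ) hpt
  rw [lintegral_const_mul' _ _ (by norm_num),
    lintegral_finsetSum _ fun k _ => measurable_const.indicator (hV k)] at h1
  simp only [lintegral_indicator_const (hV _)] at h1
  have h2 := ENNReal.toReal_mono (ENNReal.mul_ne_top (by norm_num) hfin) h1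
  rw [ENNReal.toReal_mul, ENNReal.toReal_sum fun k _ =>
    ENNReal.mul_ne_top ENNReal.ofReal_ne_top (measure_ne_top _ _)] at h2
  refine le_trans (le_of_eq (Finset.sum_congr rfl fun k _ => ?_)) (h2.trans_eq (by simp))
  rw [ENNReal.toReal_mul, ENNReal.toReal_ofReal (by positivity)]
  rfl

theorem IsMartingale.exists_pow_bound (hf : IsMartingale m μ f) (L : ℕ) {ε : ℝ} (hε : 0 < ε) :
    ∃ K : ℕ, ∀ j ≤ L, ∀ x, ‖f j x‖ ≤ ε * 4 ^ K := by
  choose B hB using fun j => exists_bound_of_dependsOn (hf.dependsOn (n := j) le_rfl)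
  obtain ⟨K, hK⟩ := pow_unbounded_of_one_lt ((∑ j ∈ Finset.range (L + 1), |B j|) / ε)
    (by norm_num : (1 : ℝ) < 4)
  refine ⟨K, fun j hj x => (hB j x).trans ((le_abs_self _).trans ?_)⟩
  rw [div_lt_iff₀' hε] at hK
  exact (Finset.single_le_sum (f := fun j => |B j|) (fun _ _ => abs_nonneg _)
    (Finset.mem_range.2 (Nat.lt_succ_of_le hj))).trans hK.le

/-- The constant of the weak-type inequality. -/
def weakConst (lam : ℕ) : ℝ :=
  60 * (lam : ℝ) ^ 2 * (3 * (lam : ℝ) ^ 3 * (1 + 4 * lam)) * (1 + 2 * lam)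

theorem IsHaar.measureReal_lt_norm_T_le (hm : ∀ k, 2 ≤ m k) (hlam : ∀ k, m k ≤ lam)
    (hμ : IsHaar m μ) (hf : IsMartingale m μ f)
    (hfin : ∫⁻ x, mstar m f x ^ (1 / 2 : ℝ) ∂μ ≠ ⊤) {q : ℕ → ℝ} (hq : Monotone q) (hq0 : 0 < q 0)
    {η τ : ℝ} (hη : 0 < η) (hη' : (∫⁻ x, mstar m f x ^ (1 / 2 : ℝ) ∂μ).toReal ≤ η) (hτ : 0 < τ)
    (L : ℕ) :
    μ.real {x | ∃ n < L, τ ^ 2 < ‖T m μ q f (n + 1) x‖} ≤ weakConst lam * η / τ := by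
  have := hμ.isProbabilityMeasure
  have hl : (1 : ℝ) ≤ lam := by exact_mod_cast (le_trans (by norm_num) (hm 0)).trans (hlam 0)
  obtain ⟨K, hK⟩ := hf.exists_pow_bound L (pow_pos hη 2)
  have h0 : ∀ x, ‖f 0 x‖ ≤ η ^ 2 := fun x => (hμ.norm_zero_le hf hfin x).trans
    (pow_le_pow_left₀ ENNReal.toReal_nonneg hη' 2)
  obtain ⟨C, hC⟩ : ∃ C, 3 * (lam : ℝ) ^ 3 * (1 + 4 * lam) = C := ⟨_, rfl⟩
  have hC1 : 1 ≤ C := by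
    rw [← hC]
    nlinarith [one_le_pow₀ hl (n := 3)]
  let P : Finset (Σ _ : ℕ, Σ _ : ℕ, Gm m) :=
    (Finset.range K).sigma fun k => atoms (passTime f L (η ^ 2 * 4 ^ k)) L
  let G : Option (Σ _ : ℕ, Σ _ : ℕ, Gm m) → Gm m → ℝ
    | none => kerMaj 0 0
    | some a => kerMaj a.2.1 a.2.2
  let b : Option (Σ _ : ℕ, Σ _ : ℕ, Gm m) → ℝ
    | none => 5 * C * η
    | some a => 5 * C * (η * 2 ^ a.1 * (M m a.2.1 : ℝ)⁻¹)
  have hb : ∀ a, 0 < b a := by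
    rintro (_ | a)
    · simp only [b]; positivity
    · have : (0 : ℝ) < M m a.2.1 := by exact_mod_cast M_pos hm _
      simp only [b]; positivity
  have hG : ∀ a, SplitsWeakly μ (6 * (lam : ℝ) ^ 2) (G a) := by
    rintro (_ | a)
    · exact hμ.splitsWeakly_kerMaj hm hlam 0 0
    · exact hμ.splitsWeakly_kerMaj hm hlam a.2.1 a.2.2
  have hG0 : ∀ a x, 0 ≤ G a x := by
    rintro (_ | a) x
    · exact kerMaj_nonneg _ _ _
    · exact kerMaj_nonneg _ _ _
  have hsub : {x | ∃ n < L, τ ^ 2 < ‖T m μ q f (n + 1) x‖} ⊆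
      {x | τ ^ 2 ≤ ∑ a ∈ Finset.insertNone P, b a ^ 2 * G a x} := by
    rintro x ⟨n, hn, hx⟩
    refine hx.le.trans (norm_T_le hq hq0
      (Finset.sum_nonneg fun a _ => mul_nonneg (sq_nonneg _) (hG0 a x)) fun j hj => ?_)
    refine (hμ.norm_sum_S_le hm hlam hf h0 hK (hj.trans hn) x).trans
      (mul_le_mul_of_nonneg_left ?_ (Nat.cast_nonneg j))
    have h5 : 5 * C ≤ (5 * C) ^ 2 := le_self_pow₀ (by linarith) (by norm_num)
    rw [hC, Finset.sum_insertNone, Finset.sum_sigma]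
    refine add_le_add ?_ (Finset.sum_le_sum fun k _ => Finset.sum_le_sum fun a _ => ?_)
    · refine mul_le_mul_of_nonneg_right ?_ (kerMaj_nonneg _ _ _)
      calc C * η ^ 2 ≤ (5 * C) ^ 2 * η ^ 2 :=
            mul_le_mul_of_nonneg_right (by linarith) (sq_nonneg _)
        _ = _ := by simp only [b]; ring
    · refine mul_le_mul_of_nonneg_right ?_ (kerMaj_nonneg _ _ _)
      calc C * (5 * η ^ 2 * 4 ^ k) * (M m a.1 : ℝ)⁻¹ ^ 2
          = 5 * C * (η ^ 2 * 4 ^ k * (M m a.1 : ℝ)⁻¹ ^ 2) := by ring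
        _ ≤ (5 * C) ^ 2 * (η ^ 2 * 4 ^ k * (M m a.1 : ℝ)⁻¹ ^ 2) :=
            mul_le_mul_of_nonneg_right h5 (by positivity)
        _ = _ := by
            simp only [b]
            rw [show (4 : ℝ) = 2 ^ 2 by norm_num, ← pow_mul]
            ring
  have hsum : ∑ a ∈ Finset.insertNone P, b a ≤ 5 * C * ((1 + 2 * lam) * η) := by
    rw [Finset.sum_insertNone, Finset.sum_sigma]
    simp only [b, ← Finset.mul_sum]
    rw [← mul_add]
    refine mul_le_mul_of_nonneg_left ?_ (by linarith)
    have h1 : ∑ k ∈ Finset.range K, η * 2 ^ k *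
          ∑ a ∈ atoms (passTime f L (η ^ 2 * 4 ^ k)) L, (M m a.1 : ℝ)⁻¹ ≤
        lam * (2 * η) := by
      calc _ ≤ ∑ k ∈ Finset.range K, η * 2 ^ k *
            (lam * μ.real {x | ∃ j ≤ L, η ^ 2 * 4 ^ k < ‖f j x‖}) :=
            Finset.sum_le_sum fun k _ => mul_le_mul_of_nonneg_left
              (hμ.sum_atoms_passTime_le hm hlam hf) (by positivity)
        _ = lam * ∑ k ∈ Finset.range K,
            η * 2 ^ k * μ.real {x | ∃ j ≤ L, η ^ 2 * 4 ^ k < ‖f j x‖} := by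
            rw [Finset.mul_sum]
            exact Finset.sum_congr rfl fun k _ => by ring
        _ ≤ _ := mul_le_mul_of_nonneg_left
            ((hμ.sum_dyadic_measureReal_le hf hfin hη.le K).trans (by linarith)) (by linarith)
    linarith
  calc _ ≤ μ.real {x | τ ^ 2 ≤ ∑ a ∈ Finset.insertNone P, b a ^ 2 * G a x} :=
        measureReal_mono hsub (measure_ne_top _ _)
    _ ≤ 2 * (6 * (lam : ℝ) ^ 2) / τ * ∑ a ∈ Finset.insertNone P, b a :=
        measureReal_sum_ge_le hG _ hb hτ
    _ ≤ 2 * (6 * (lam : ℝ) ^ 2) / τ * (5 * C * ((1 + 2 * lam) * η)) :=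
        mul_le_mul_of_nonneg_left hsum (by positivity)
    _ = _ := by rw [weakConst, hC]; ring

theorem IsHaar.measureReal_lt_iSup_T_le (hm : ∀ k, 2 ≤ m k) (hlam : ∀ k, m k ≤ lam)
    (hμ : IsHaar m μ) (hf : IsMartingale m μ f)
    (hfin : ∫⁻ x, mstar m f x ^ (1 / 2 : ℝ) ∂μ ≠ ⊤) {q : ℕ → ℝ} (hq : Monotone q) (hq0 : 0 < q 0)
    {τ : ℝ} (hτ : 0 < τ) :
    μ {x | ENNReal.ofReal (τ ^ 2) < ⨆ n : ℕ, (‖T m μ q f (n + 1) x‖₊ : ℝ≥0∞)} ≤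
      ENNReal.ofReal (weakConst lam * (∫⁻ x, mstar m f x ^ (1 / 2 : ℝ) ∂μ).toReal / τ) := by
  have := hμ.isProbabilityMeasure
  set h := (∫⁻ x, mstar m f x ^ (1 / 2 : ℝ) ∂μ).toReal with hh
  have hc : 0 < weakConst lam := by
    have : (0 : ℝ) < lam := by exact_mod_cast ((hm 0).trans (hlam 0)).trans_lt' (by norm_num)
    unfold weakConst
    positivity
  have hset : {x | ENNReal.ofReal (τ ^ 2) < ⨆ n : ℕ, (‖T m μ q f (n + 1) x‖₊ : ℝ≥0∞)} =
      ⋃ L : ℕ, {x | ∃ n < L, τ ^ 2 < ‖T m μ q f (n + 1) x‖} := by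
    ext x
    simp only [Set.mem_iUnion, Set.mem_ofPred, lt_iSup_iff]
    have key : ∀ n, ENNReal.ofReal (τ ^ 2) < (‖T m μ q f (n + 1) x‖₊ : ℝ≥0∞) ↔
        τ ^ 2 < ‖T m μ q f (n + 1) x‖ := fun n => by
      rw [ENNReal.ofReal_lt_coe_iff (by positivity), coe_nnnorm]
    simp only [key]
    exact ⟨fun ⟨n, hn⟩ => ⟨n + 1, n, n.lt_succ_self, hn⟩, fun ⟨_, n, _, hn⟩ => ⟨n, hn⟩⟩
  have hmono : Monotone fun L : ℕ => {x | ∃ n < L, τ ^ 2 < ‖T m μ q f (n + 1) x‖} :=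
    fun L L' hL x ⟨n, hn, hx⟩ => ⟨n, hn.trans_le hL, hx⟩
  rw [hset, hmono.measure_iUnion]
  refine iSup_le fun L => ?_
  rw [← ENNReal.ofReal_toReal (measure_ne_top μ _)]
  refine ENNReal.ofReal_le_ofReal (le_of_forall_pos_le_add fun e he => ?_)
  have hh0 : 0 ≤ h := ENNReal.toReal_nonneg
  have hδ : 0 < e * τ / weakConst lam := by positivity
  refine (hμ.measureReal_lt_norm_T_le hm hlam hf hfin hq hq0 (η := h + e * τ / weakConst lam)
    (by linarith) (by linarith) hτ L).trans (le_of_eq ?_)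
  field_simp

end WeakBound

end Vilenkin

/-- for any non-decreasing nonnegative `(q_k)` with `q_0 > 0`, the
maximal operator `t* f = sup_{n ≥ 1} |t_n f|` of the Nörlund means satisfies
`‖t* f‖_{weak-L_{1/2}} ≤ c ‖f‖_{H_{1/2}}` for every martingale `f ∈ H_{1/2}`,
where `c > 0` depends only on `λ = sup m_k`. -/
theorem statement18 (lam : ℕ) :
    ∃ c : ℝ, 0 < c ∧
      ∀ (m : ℕ → ℕ), (∀ k, 2 ≤ m k) → (∀ k, m k ≤ lam) →
      ∀ (q : ℕ → ℝ), (∀ k, 0 ≤ q k) → Monotone q → 0 < q 0 →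
      ∀ (μ : Measure (Gm m)), Vilenkin.IsHaar m μ →
      ∀ (f : ℕ → Gm m → ℂ), Vilenkin.IsMartingale m μ f →
        Vilenkin.MemHp m μ (1 / 2) f →
        Vilenkin.wLp m μ (1 / 2)
            (fun x => ⨆ n : ℕ, (‖Vilenkin.T m μ q f (n + 1) x‖₊ : ℝ≥0∞)) ≤
          ENNReal.ofReal c * Vilenkin.eLp m μ (1 / 2) (Vilenkin.mstar m f) := by
  refine ⟨Vilenkin.weakConst lam ^ 2 + 1, by positivity, ?_⟩
  intro m hm hlam q _ hq hq0 μ hμ f hf hfin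
  have : ∀ k, NeZero (m k) := fun k => ⟨by have := hm k; omega⟩
  have h2 : (1 : ℝ) / (1 / 2) = 2 := by norm_num
  have hH : ∫⁻ x, Vilenkin.mstar m f x ^ (1 / 2 : ℝ) ∂μ ≠ ⊤ := fun h => hfin <| by
    rw [Vilenkin.eLp, h, h2]
    exact ENNReal.top_rpow_of_pos two_pos
  rw [Vilenkin.wLp, Vilenkin.eLp, h2, ← ENNReal.ofReal_toReal hH]
  set h := (∫⁻ x, Vilenkin.mstar m f x ^ (1 / 2 : ℝ) ∂μ).toReal
  have hh : 0 ≤ h := ENNReal.toReal_nonneg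
  refine iSup_le fun t => ?_
  rcases eq_zero_or_pos t with rfl | ht
  · simp
  have hτ : 0 < √(t : ℝ) := Real.sqrt_pos.2 ht
  have ht' : (t : ℝ≥0∞) = ENNReal.ofReal (√(t : ℝ) ^ 2) := by
    rw [Real.sq_sqrt t.coe_nonneg, ENNReal.ofReal_coe_nnreal]
  have hc : 0 ≤ Vilenkin.weakConst lam := by
    unfold Vilenkin.weakConst
    positivity
  rw [ht', ENNReal.rpow_ofNat, ENNReal.rpow_ofNat]
  calc _ ≤ ENNReal.ofReal (√(t : ℝ) ^ 2) *
        ENNReal.ofReal (Vilenkin.weakConst lam * h / √(t : ℝ)) ^ 2 :=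
        mul_le_mul_right (pow_le_pow_left₀ zero_le
          (hμ.measureReal_lt_iSup_T_le hm hlam hf hH hq hq0 hτ) 2) _
    _ = ENNReal.ofReal (Vilenkin.weakConst lam ^ 2 * h ^ 2) := by
        rw [← ENNReal.ofReal_pow (by positivity), ← ENNReal.ofReal_mul (by positivity)]
        congr 1
        field_simp
    _ ≤ _ := by
        rw [← ENNReal.ofReal_pow hh, ← ENNReal.ofReal_mul (by positivity)]
        exact ENNReal.ofReal_le_ofReal (by nlinarith [sq_nonneg h])
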